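/- arXiv:2207.04647 — 9 statements merged into one kernel-verified Lean document; each statement's English description precedes it below -/
import Mathlib

section
/- Let A : ℕ → ℤ and B : ℕ → ℕ be primitive recursive functions with B(n) > 0 for all n, and let q(n) = A(n)/B(n) be the resulting sequence of rational numbers. Suppose there is a primitive recursive function C : ℕ → ℕ which is a Cauchy modulus for q, i.e. for every e ∈ ℕ and all i, j ≥ C(e) one has |q(i) − q(j)| < 2^{−e}. Then the sequence q converges to some real number x, and x is SPRCN-representable. -/
open Filter

/-- A real number `x` is SPRCN-representable if there exist an integer `I` and a
primitive recursive function `P : ℕ → ℤ` taking values in `{-1, 0, 1}` such that the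
partial sums `I + ∑_{i=1}^n P(i)·2^{−i}` converge to `x`. -/
def SPRCNRep (x : ℝ) : Prop :=
  ∃ (I : ℤ) (P : ℕ → ℤ), Primrec P ∧ (∀ i, P i = -1 ∨ P i = 0 ∨ P i = 1) ∧
    Tendsto (fun n => (I : ℝ) + ∑ i ∈ Finset.Icc 1 n, (P i : ℝ) / 2 ^ i)
      atTop (nhds x)

theorem Int.encode_natCast (n : ℕ) : Encodable.encode (n : ℤ) = 2 * n := rfl

theorem Int.encode_negSucc (n : ℕ) : Encodable.encode (Int.negSucc n) = 2 * n + 1 := rfl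

theorem Primrec.int_toNat : Primrec Int.toNat := by
  have h : Primrec fun z : ℤ =>
      if Encodable.encode z % 2 = 0 then Encodable.encode z / 2 else 0 :=
    Primrec.ite
      (Primrec.eq.comp (Primrec.nat_mod.comp Primrec.encode (Primrec.const 2)) (Primrec.const 0))
      (Primrec.nat_div.comp Primrec.encode (Primrec.const 2)) (Primrec.const 0)
  refine h.of_eq fun z => ?_
  cases z with
  | ofNat n => simp [Int.encode_natCast]
  | negSucc n => simp [Int.encode_negSucc, Nat.add_mod]

theorem Primrec.int_toNat_neg : Primrec fun z : ℤ => (-z).toNat := by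
  have h : Primrec fun z : ℤ =>
      if Encodable.encode z % 2 = 0 then 0 else Encodable.encode z / 2 + 1 :=
    Primrec.ite
      (Primrec.eq.comp (Primrec.nat_mod.comp Primrec.encode (Primrec.const 2)) (Primrec.const 0))
      (Primrec.const 0)
      (Primrec.succ.comp (Primrec.nat_div.comp Primrec.encode (Primrec.const 2)))
  refine h.of_eq fun z => ?_
  cases z with
  | ofNat n => simp [Int.encode_natCast]
  | negSucc n =>
    have h₁ : ¬ Encodable.encode (Int.negSucc n) % 2 = 0 := by
      rw [Int.encode_negSucc]
      omega
    rw [if_neg h₁, Int.encode_negSucc, Int.neg_negSucc, Int.toNat_natCast]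
    omega

theorem Primrec.nat_pow : Primrec₂ ((· ^ ·) : ℕ → ℕ → ℕ) :=
  Primrec₂.unpaired'.1 Nat.Primrec.pow

/-- The natural number `(2 * a + b) / (2 * b)` is a nearest integer to `a / b`. -/
theorem abs_nat_round_div_sub_le (a b : ℕ) (hb : 0 < b) :
    |(((2 * a + b) / (2 * b) : ℕ) : ℝ) - a / b| ≤ 1 / 2 := by
  have hb' : (0 : ℝ) < b := by exact_mod_cast hb
  have h₁ : 2 * b * ((2 * a + b) / (2 * b)) ≤ 2 * a + b := Nat.mul_div_le _ _
  have h₂ : 2 * a + b < 2 * b * ((2 * a + b) / (2 * b) + 1) :=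
    Nat.lt_mul_div_succ _ (by omega)
  generalize (2 * a + b) / (2 * b) = c at h₁ h₂ ⊢
  have h₁' : (2 * b * c : ℝ) ≤ 2 * a + b := by exact_mod_cast h₁
  have h₂' : (2 * a + b : ℝ) < 2 * b * (c + 1) := by exact_mod_cast h₂
  have h₃ : (a / b : ℝ) * b = a := div_mul_cancel₀ _ hb'.ne'
  rw [abs_le]
  constructor <;> nlinarith

/-- A primitive recursive sequence of dyadic approximations of a shift of `x`, with numerators
accurate to less than `2 / 3`, yields a signed binary expansion of `x`. -/
theorem SPRCNRep.of_abs_sub_lt {x : ℝ} (K : ℕ) {m : ℕ → ℕ} (hm : Primrec m)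
    (h : ∀ n, |(m n : ℝ) - 2 ^ n * (x + K)| < 2 / 3) : SPRCNRep x := by
  let P : ℕ → ℤ := fun i =>
    if m i = 2 * m (i - 1) + 1 then 1 else if m i + 1 = 2 * m (i - 1) then -1 else 0
  have hprev : Primrec fun i => 2 * m (i - 1) :=
    Primrec.nat_mul.comp (Primrec.const 2) (hm.comp Primrec.pred)
  have hP : Primrec P :=
    Primrec.ite (Primrec.eq.comp hm (Primrec.succ.comp hprev)) (Primrec.const 1)
      (Primrec.ite (Primrec.eq.comp (Primrec.succ.comp hm) hprev) (Primrec.const (-1))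
        (Primrec.const 0))
  have hstep : ∀ n, P (n + 1) = (m (n + 1) : ℤ) - 2 * m n := by
    intro n
    have h₁ := abs_lt.1 (h n)
    have h₂ := abs_lt.1 (h (n + 1))
    rw [pow_succ] at h₂
    have h₃ : (m (n + 1) : ℤ) < 2 * m n + 2 := by
      have : (m (n + 1) : ℝ) < 2 * m n + 2 := by linarith [h₁.1, h₂.2]
      exact_mod_cast this
    have h₄ : (2 * m n : ℤ) < m (n + 1) + 2 := by
      have : (2 * m n : ℝ) < m (n + 1) + 2 := by linarith [h₁.2, h₂.1]
      exact_mod_cast this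
    simp only [P, Nat.add_sub_cancel]
    split_ifs <;> omega
  have hsum : ∀ n, (((m 0 : ℤ) - K : ℤ) : ℝ) + ∑ i ∈ Finset.Icc 1 n, (P i : ℝ) / 2 ^ i =
      m n / 2 ^ n - K := by
    intro n
    induction n with
    | zero => simp
    | succ n ih =>
      rw [Finset.sum_Icc_succ_top (by omega), ← add_assoc, ih, hstep]
      push_cast
      field_simp
      ring
  refine ⟨m 0 - K, P, hP, fun i => ?_, ?_⟩
  · simp only [P]
    split_ifs <;> simp
  · simp only [hsum]
    rw [tendsto_iff_dist_tendsto_zero]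
    refine squeeze_zero (fun _ => dist_nonneg) (fun n => ?_)
      (tendsto_pow_atTop_nhds_zero_of_lt_one (r := (1 / 2 : ℝ)) (by norm_num) (by norm_num))
    have h2 : (0 : ℝ) < 2 ^ n := by positivity
    have heq : (m n / 2 ^ n - K - x : ℝ) = (m n - 2 ^ n * (x + K)) / 2 ^ n := by
      field_simp
      ring
    rw [Real.dist_eq, heq, abs_div, abs_of_pos h2, div_pow, one_pow]
    gcongr
    linarith [h n]

theorem stmt_0 (A : ℕ → ℤ) (B : ℕ → ℕ) (hA : Primrec A) (hB : Primrec B)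
    (hBpos : ∀ n, 0 < B n)
    (q : ℕ → ℚ) (hq : ∀ n, q n = (A n : ℚ) / (B n : ℚ))
    (C : ℕ → ℕ) (hC : Primrec C)
    (hmod : ∀ e i j, C e ≤ i → C e ≤ j → |q i - q j| < ((2 : ℚ) ^ e)⁻¹) :
    ∃ x : ℝ, Tendsto (fun n => (q n : ℝ)) atTop (nhds x) ∧ SPRCNRep x := by
  have hmodR : ∀ e i j, C e ≤ i → C e ≤ j → |(q i : ℝ) - q j| < ((2 : ℝ) ^ e)⁻¹ := by
    intro e i j hi hj
    have h := (Rat.cast_lt (K := ℝ)).2 (hmod e i j hi hj)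
    push_cast at h
    exact h
  have hcauchy : CauchySeq fun n => (q n : ℝ) := by
    refine Metric.cauchySeq_iff.2 fun ε hε => ?_
    obtain ⟨e, he⟩ := exists_pow_lt_of_lt_one hε (by norm_num : (1 / 2 : ℝ) < 1)
    refine ⟨C e, fun i hi j hj => ?_⟩
    rw [Real.dist_eq]
    rw [div_pow, one_pow, one_div] at he
    exact (hmodR e i j hi hj).trans he
  obtain ⟨x, hx⟩ := cauchySeq_tendsto_of_complete hcauchy
  refine ⟨x, hx, ?_⟩
  have hlim : ∀ e i, C e ≤ i → |(q i : ℝ) - x| ≤ ((2 : ℝ) ^ e)⁻¹ := fun e i hi =>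
    le_of_tendsto (tendsto_const_nhds.sub hx).abs
      (eventually_atTop.2 ⟨C e, fun j hj => (hmodR e i j hi hj).le⟩)
  obtain ⟨K, hK⟩ := exists_nat_gt (|q (C 0)| + 1)
  let N : ℕ → ℕ := fun n => (A n).toNat + K * B n - (-A n).toNat
  have hN : Primrec N :=
    Primrec.nat_sub.comp
      (Primrec.nat_add.comp (Primrec.int_toNat.comp hA)
        (Primrec.nat_mul.comp (Primrec.const K) hB))
      (Primrec.int_toNat_neg.comp hA)
  have hNq : ∀ n, C 0 ≤ n → (N n : ℝ) / B n = q n + K := by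
    intro n hn
    have hBn : (0 : ℚ) < B n := by exact_mod_cast hBpos n
    have h₁ := abs_lt.1 (hmod 0 n (C 0) hn le_rfl)
    have h₂ : 0 ≤ q n + K := by
      rw [pow_zero, inv_one] at h₁
      linarith [neg_abs_le (q (C 0)), h₁.1]
    have h₃ : (0 : ℤ) ≤ A n + K * B n := by
      have h₄ : (q n + K) * B n = A n + K * B n := by
        rw [hq]
        field_simp
      have : (0 : ℚ) ≤ A n + K * B n := h₄ ▸ mul_nonneg h₂ hBn.le
      exact_mod_cast this
    have h₅ : (N n : ℤ) = A n + K * B n := by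
      simp only [N]
      rw [← Nat.cast_mul] at h₃ ⊢
      omega
    have h₆ : (N n : ℝ) = A n + K * B n := by exact_mod_cast h₅
    have hBn' : (B n : ℝ) ≠ 0 := by exact_mod_cast (hBpos n).ne'
    rw [h₆, hq]
    push_cast
    field_simp
  let J : ℕ → ℕ := fun n => C (n + 3) + C 0
  have hJ : Primrec J :=
    Primrec.nat_add.comp
      (hC.comp (Primrec.nat_add.comp Primrec.id (Primrec.const 3))) (Primrec.const (C 0))
  have hBJ : Primrec fun n => B (J n) := hB.comp hJ
  refine SPRCNRep.of_abs_sub_lt K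
    (m := fun n => (2 * (2 ^ n * N (J n)) + B (J n)) / (2 * B (J n))) ?_ fun n => ?_
  · exact Primrec.nat_div.comp
      (Primrec.nat_add.comp
        (Primrec.nat_mul.comp (Primrec.const 2)
          (Primrec.nat_mul.comp (Primrec.nat_pow.comp (Primrec.const 2) Primrec.id)
            (hN.comp hJ))) hBJ)
      (Primrec.nat_mul.comp (Primrec.const 2) hBJ)
  · have h₁ := abs_nat_round_div_sub_le (2 ^ n * N (J n)) (B (J n)) (hBpos _)
    have h₂ := hlim (n + 3) (J n) (Nat.le_add_right _ _)
    have h₃ : |(2 : ℝ) ^ n * (q (J n) + K) - 2 ^ n * (x + K)| ≤ 1 / 8 := by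
      have h2 : (0 : ℝ) < 2 ^ n := by positivity
      rw [← mul_sub, abs_mul, abs_of_pos h2, add_sub_add_right_eq_sub]
      calc (2 : ℝ) ^ n * |(q (J n) : ℝ) - x| ≤ 2 ^ n * (2 ^ (n + 3))⁻¹ := by gcongr
        _ = 1 / 8 := by
          rw [pow_add]
          field_simp
          norm_num
    rw [Nat.cast_mul, mul_div_assoc, hNq _ (Nat.le_add_left _ _), Nat.cast_pow,
      Nat.cast_ofNat] at h₁
    calc _ ≤ _ := abs_sub_le _ ((2 : ℝ) ^ n * (q (J n) + K)) _
      _ ≤ 1 / 2 + 1 / 8 := add_le_add h₁ h₃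
      _ < 2 / 3 := by norm_num
end

section
/- There exists a computable real number that is not SPRCN-representable; that is, there exists a real number x together with a computable sequence q : ℕ → ℚ satisfying |q(n) − q(m)| ≤ 2^{−m} for all n ≥ m and converging to x, such that for every integer I and every primitive recursive function P : ℕ → ℤ with values in {-1, 0, 1}, the partial sums I + ∑_{i=1}^n P(i)·2^{−i} do not converge to x. -/
open Filter

open Encodable Nat.Partrec

theorem encode_rat_eq_countP (x : ℚ) : @encode ℚ Rat.instDenumerable.toEncodable x =
    (List.range (Nat.pair (Equiv.intEquivNat x.num) x.den)).countP
      (fun m => @decide (m ∈ Set.range (@encode ℚ Rat.instEncodable))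
        (decidableRangeEncode ℚ m)) := rfl

theorem mem_range_encode_rat_iff (m : ℕ) : m ∈ Set.range (@encode ℚ Rat.instEncodable) ↔
    m.unpair.2 ≠ 0 ∧ ((m.unpair.1 + 1) / 2).Coprime m.unpair.2 := by
  have key : ∀ u : ℕ, (Equiv.intEquivNat.symm u).natAbs = (u + 1) / 2 := by
    intro u
    obtain ⟨z, rfl⟩ := Equiv.intEquivNat.surjective u
    rw [Equiv.symm_apply_apply]
    cases z with
    | ofNat a => change a = (2 * a + 1) / 2; omega
    | negSucc a => change a + 1 = (2 * a + 1 + 1) / 2; omega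
  constructor
  · rintro ⟨x, rfl⟩
    change (Nat.pair (Equiv.intEquivNat x.num) x.den).unpair.2 ≠ 0 ∧
      (((Nat.pair (Equiv.intEquivNat x.num) x.den).unpair.1 + 1) / 2).Coprime
        (Nat.pair (Equiv.intEquivNat x.num) x.den).unpair.2
    rw [Nat.unpair_pair, ← key, Equiv.symm_apply_apply]
    exact ⟨x.den_nz, x.reduced⟩
  · rintro ⟨h0, h⟩
    rw [← key] at h
    refine ⟨⟨_, _, h0, h⟩, ?_⟩
    change Nat.pair (Equiv.intEquivNat (Equiv.intEquivNat.symm m.unpair.1)) m.unpair.2 = m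
    rw [Equiv.apply_symm_apply, Nat.pair_unpair]

theorem coprime_iff_forall_mod {a d : ℕ} (hd : d ≠ 0) :
    a.Coprime d ↔ ∀ k < d + 1, ¬ (d % k = 0 ∧ a % k = 0 ∧ ¬ k = 1) := by
  constructor
  · rintro h k - ⟨h1, h2, h3⟩
    exact h3 (Nat.eq_one_of_dvd_coprimes h (Nat.dvd_of_mod_eq_zero h2) (Nat.dvd_of_mod_eq_zero h1))
  · intro h
    by_contra hc
    exact h (a.gcd d) (Nat.lt_succ_of_le (Nat.gcd_le_right _ (Nat.pos_of_ne_zero hd)))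
      ⟨Nat.mod_eq_zero_of_dvd (Nat.gcd_dvd_right a d),
        Nat.mod_eq_zero_of_dvd (Nat.gcd_dvd_left a d), hc⟩

theorem primrecPred_mem_range_encode_rat :
    PrimrecPred fun m => m ∈ Set.range (@encode ℚ Rat.instEncodable) := by
  have hd : Primrec fun m : ℕ => m.unpair.2 := Primrec.snd.comp .unpair
  have ha : Primrec fun m : ℕ => (m.unpair.1 + 1) / 2 :=
    Primrec.nat_div.comp (Primrec.succ.comp (Primrec.fst.comp .unpair)) (.const 2)
  have hR : PrimrecRel fun k m : ℕ =>
      ¬ (m.unpair.2 % k = 0 ∧ (m.unpair.1 + 1) / 2 % k = 0 ∧ ¬ k = 1) := by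
    refine PrimrecPred.not (PrimrecPred.and ?_ (PrimrecPred.and ?_ (PrimrecPred.not ?_)))
    · exact Primrec.eq.comp (Primrec.nat_mod.comp (hd.comp .snd) .fst) (.const 0)
    · exact Primrec.eq.comp (Primrec.nat_mod.comp (ha.comp .snd) .fst) (.const 0)
    · exact Primrec.eq.comp .fst (.const 1)
  refine (PrimrecPred.and (PrimrecPred.not (Primrec.eq.comp hd (.const 0)))
    (hR.forall_lt.comp (Primrec.succ.comp hd) .id)).of_eq fun m => ?_
  rw [mem_range_encode_rat_iff]
  exact and_congr_right fun h => (coprime_iff_forall_mod h).symm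

theorem primrec_countP_range {p : ℕ → Prop} [DecidablePred p] (hp : PrimrecPred p) :
    Primrec fun n => (List.range n).countP fun m => decide (p m) := by
  have h : Primrec₂ fun (n s : ℕ) => s + if p n then 1 else 0 :=
    Primrec.nat_add.comp .snd (Primrec.ite (hp.comp .fst) (.const 1) (.const 0))
  refine (Primrec.nat_rec₁ 0 h).of_eq fun n => ?_
  induction n with
  | zero => rfl
  | succ n ih => simp [List.range_succ, List.countP_append, List.countP_singleton, ← ih]

/-- A rational sequence given in lowest terms by computable numerators and denominators is
computable. -/
theorem computable_rat_div_of_coprime {a d : ℕ → ℕ} (ha : Computable a) (hd : Computable d)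
    (h0 : ∀ n, d n ≠ 0) (h : ∀ n, (a n).Coprime (d n)) :
    Computable fun n => (a n : ℚ) / (d n : ℚ) := by
  let _ := decidableRangeEncode ℚ
  refine Computable.encode_iff.1 ?_
  refine ((primrec_countP_range primrecPred_mem_range_encode_rat).to_comp.comp
    (Primrec₂.natPair.to_comp.comp
      (Primrec.nat_mul.to_comp.comp (Computable.const 2) ha) hd)).of_eq fun n => ?_
  have hx : (a n : ℚ) / (d n : ℚ) = ⟨(a n : ℤ), d n, h0 n, h n⟩ := by
    rw [← Rat.num_div_den ⟨(a n : ℤ), d n, h0 n, h n⟩, Int.cast_natCast]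
  rw [hx]
  exact (encode_rat_eq_countP ⟨(a n : ℤ), d n, h0 n, h n⟩).symm

/-- Evaluate a code, reading each unbounded search as the constant function zero. -/
def primEval : Code → ℕ → ℕ
  | .zero => fun _ => 0
  | .succ => Nat.succ
  | .left => fun n => n.unpair.1
  | .right => fun n => n.unpair.2
  | .pair cf cg => fun n => Nat.pair (primEval cf n) (primEval cg n)
  | .comp cf cg => fun n => primEval cf (primEval cg n)
  | .prec cf cg => Nat.unpaired fun z n =>
      n.rec (primEval cf z) fun y IH => primEval cg (Nat.pair z (Nat.pair y IH))
  | .rfind' _ => fun _ => 0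

/-- Replace each unbounded search in a code by the code for the constant function zero. -/
def removeSearch (c : Code) : Code :=
  Code.recOn c .zero .succ .left .right (fun _ _ f g => .pair f g) (fun _ _ f g => .comp f g)
    (fun _ _ f g => .prec f g) (fun _ _ => .zero)

theorem primrec_removeSearch : Primrec removeSearch := by
  have hf : Primrec fun a : Code × Code × Code × Code × Code => a.2.2.2.1 :=
    Primrec.fst.comp (Primrec.snd.comp (Primrec.snd.comp .snd))
  have hg : Primrec fun a : Code × Code × Code × Code × Code => a.2.2.2.2 :=
    Primrec.snd.comp (Primrec.snd.comp (Primrec.snd.comp .snd))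
  have hpr := Code.primrec₂_pair.comp hf hg
  have hco := Code.primrec₂_comp.comp hf hg
  have hpc := Code.primrec₂_prec.comp hf hg
  have hrf : Primrec fun _ : Code × Code × Code => Code.zero := .const _
  exact Code.primrec_recOn (α := Code) (σ := Code) (c := id) Primrec.id
    (z := fun _ => .zero) (.const _) (s := fun _ => .succ) (.const _)
    (l := fun _ => .left) (.const _) (r := fun _ => .right) (.const _)
    (pr := fun _ _ _ f g => .pair f g) hpr (co := fun _ _ _ f g => .comp f g) hco
    (pc := fun _ _ _ f g => .prec f g) hpc (rf := fun _ _ _ => .zero) hrf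

theorem eval_removeSearch (c : Code) (n : ℕ) :
    (removeSearch c).eval n = Part.some (primEval c n) := by
  induction c generalizing n with
  | zero => rfl
  | succ => rfl
  | left => rfl
  | right => rfl
  | pair cf cg hf hg =>
    change Nat.pair <$> (removeSearch cf).eval n <*> (removeSearch cg).eval n = _
    simp [hf, hg, Seq.seq, primEval]
  | comp cf cg hf hg =>
    change (removeSearch cg).eval n >>= (removeSearch cf).eval = _
    rw [hg]
    exact (Part.bind_some _ _).trans (hf _)
  | prec cf cg hf hg =>
    change Code.eval (.prec (removeSearch cf) (removeSearch cg)) n = _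
    obtain ⟨⟨a, m⟩, rfl⟩ : ∃ p : ℕ × ℕ, n = Nat.pair p.1 p.2 :=
      ⟨n.unpair, (Nat.pair_unpair n).symm⟩
    simp only [primEval, Nat.unpaired, Nat.unpair_pair]
    induction m with
    | zero => exact (Code.eval_prec_zero _ _ _).trans (hf a)
    | succ m ih => rw [Code.eval_prec_succ, ih]; simp [hg]
  | rfind' cf hf => rfl

theorem computable₂_primEval : Computable₂ primEval :=
  Partrec.of_eq (Code.eval_part.comp (primrec_removeSearch.to_comp.comp .fst) .snd)
    fun p => eval_removeSearch p.1 p.2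

theorem exists_primEval_eq {f : ℕ → ℕ} (hf : Nat.Primrec f) : ∃ c, primEval c = f := by
  induction hf with
  | zero => exact ⟨.zero, rfl⟩
  | succ => exact ⟨.succ, rfl⟩
  | left => exact ⟨.left, rfl⟩
  | right => exact ⟨.right, rfl⟩
  | pair _ _ hf hg =>
    obtain ⟨⟨cf, rfl⟩, cg, rfl⟩ := hf, hg
    exact ⟨.pair cf cg, rfl⟩
  | comp _ _ hf hg =>
    obtain ⟨⟨cf, rfl⟩, cg, rfl⟩ := hf, hg
    exact ⟨.comp cf cg, rfl⟩
  | prec _ _ hf hg =>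
    obtain ⟨⟨cf, rfl⟩, cg, rfl⟩ := hf, hg
    exact ⟨.prec cf cg, rfl⟩

/-- The numerators of the diagonal sequence `diagNum n / 8 ^ n`. -/
def diagNum : ℕ → ℕ
  | 0 => 1
  | n + 1 => 8 * diagNum n +
      if primEval (Denumerable.ofNat Code n) (3 * (n + 1)) < 8 * diagNum n + 3 then 5 else 1

theorem computable_diagNum : Computable diagNum := by
  have hF : Computable fun p : ℕ × ℕ =>
      primEval (Denumerable.ofNat Code p.1) (3 * (p.1 + 1)) :=
    computable₂_primEval.comp ((Computable.ofNat Code).comp .fst)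
      (Primrec.nat_mul.comp (.const 3) (Primrec.succ.comp .fst)).to_comp
  have hstep : Primrec₂ fun (p : ℕ × ℕ) (v : ℕ) =>
      8 * p.2 + if v < 8 * p.2 + 3 then 5 else 1 := by
    have h8 : Primrec fun t : (ℕ × ℕ) × ℕ => 8 * t.1.2 :=
      Primrec.nat_mul.comp (.const 8) (Primrec.snd.comp .fst)
    exact Primrec.nat_add.comp h8 (Primrec.ite
      (Primrec.nat_lt.comp .snd (Primrec.nat_add.comp h8 (.const 3))) (.const 5) (.const 1))
  have hs : Computable₂ fun (_ : ℕ) (p : ℕ × ℕ) => 8 * p.2 +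
      if primEval (Denumerable.ofNat Code p.1) (3 * (p.1 + 1)) < 8 * p.2 + 3 then 5 else 1 :=
    (hstep.to_comp.comp .id hF).comp .snd
  refine (Computable.nat_rec .id (.const 1) hs).of_eq fun n => ?_
  induction n with
  | zero => rfl
  | succ n ih => exact (congrArg (fun t => 8 * t +
      if primEval (Denumerable.ofNat Code n) (3 * (n + 1)) < 8 * t + 3 then 5 else 1) ih)

theorem odd_diagNum (n : ℕ) : Odd (diagNum n) := by
  cases n with
  | zero => exact odd_one
  | succ n => rw [diagNum, Nat.odd_iff]; split_ifs <;> omega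

/-- The computable sequence converging to the diagonal real. -/
def diagSeq (n : ℕ) : ℚ := (diagNum n : ℚ) / ((8 ^ n : ℕ) : ℚ)

theorem computable_diagSeq : Computable diagSeq := by
  have hmul : Primrec₂ fun _ s : ℕ => 8 * s := (Primrec.nat_mul.comp (.const 8) .snd).to₂
  have hpow : Primrec fun n : ℕ => 8 ^ n := (Primrec.nat_rec₁ 1 hmul).of_eq fun n => by
    induction n with
    | zero => rfl
    | succ n ih => rw [pow_succ', ← ih]
  refine computable_rat_div_of_coprime computable_diagNum hpow.to_comp (fun n => by positivity)
    fun n => Nat.Coprime.pow_right n ?_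
  exact (Nat.coprime_two_right.2 (odd_diagNum n)).pow_right 3

theorem diagSeq_monotone : Monotone diagSeq := by
  refine monotone_nat_of_le_succ fun n => ?_
  rw [diagSeq, diagSeq, div_le_div_iff₀ (by positivity) (by positivity)]
  have : 8 * diagNum n ≤ diagNum (n + 1) := Nat.le_add_right _ _
  have : (8 * diagNum n : ℚ) ≤ diagNum (n + 1) := by exact_mod_cast this
  push_cast [pow_succ]
  nlinarith [pow_pos (by norm_num : (0 : ℚ) < 8) n]

theorem diagSeq_add_antitone : Antitone fun n => diagSeq n + 5 / 7 / 8 ^ n := by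
  refine antitone_nat_of_succ_le fun n => ?_
  have : diagNum (n + 1) ≤ 8 * diagNum n + 5 := by rw [diagNum]; split_ifs <;> omega
  have : (diagNum (n + 1) : ℚ) ≤ 8 * diagNum n + 5 := by exact_mod_cast this
  simp only [diagSeq]
  push_cast
  rw [← add_div, ← add_div, div_le_div_iff₀ (by positivity) (by positivity), pow_succ]
  nlinarith [pow_pos (by norm_num : (0 : ℚ) < 8) n]

theorem diagSeq_le_of_le {m n : ℕ} (h : m ≤ n) : diagSeq n ≤ diagSeq m + 5 / 7 / 8 ^ m :=
  le_trans (le_add_of_nonneg_right (by positivity)) (diagSeq_add_antitone h)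

theorem abs_diagSeq_sub_le {m n : ℕ} (h : m ≤ n) :
    |diagSeq n - diagSeq m| ≤ ((2 : ℚ) ^ m)⁻¹ := by
  rw [abs_of_nonneg (sub_nonneg.2 (diagSeq_monotone h)), sub_le_iff_le_add']
  refine (diagSeq_le_of_le h).trans (add_le_add_right ?_ _)
  rw [← one_div]
  gcongr <;> norm_num

theorem exists_tendsto_diagSeq : ∃ x : ℝ, Tendsto (fun n => (diagSeq n : ℝ)) atTop (nhds x) := by
  refine ⟨_, tendsto_atTop_ciSup (fun m n h => Rat.cast_le.2 (diagSeq_monotone h))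
    ⟨((diagSeq 0 + 5 / 7 / 8 ^ 0 : ℚ) : ℝ), ?_⟩⟩
  rintro _ ⟨n, rfl⟩
  exact Rat.cast_le.2 (diagSeq_le_of_le n.zero_le)

/-- The integer `2 ^ n * (I + ∑ i ∈ Icc 1 n, P i / 2 ^ i)`. -/
def signedNum (I : ℤ) (P : ℕ → ℤ) : ℕ → ℤ
  | 0 => I
  | n + 1 => 2 * signedNum I P n + P (n + 1)

theorem sum_signed_digits_eq (I : ℤ) (P : ℕ → ℤ) (n : ℕ) :
    (I : ℝ) + ∑ i ∈ Finset.Icc 1 n, (P i : ℝ) / 2 ^ i = signedNum I P n / 2 ^ n := by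
  induction n with
  | zero => simp [signedNum]
  | succ n ih =>
    rw [Finset.sum_Icc_succ_top (by omega), ← add_assoc, ih, signedNum]
    push_cast
    field_simp
    ring

theorem primrec_toNat_signedNum {P : ℕ → ℤ} (hP : Primrec P)
    (hd : ∀ i, P i = -1 ∨ P i = 0 ∨ P i = 1) (I : ℤ) :
    Primrec fun n => (signedNum I P n).toNat := by
  have haux : ∀ (b : ℕ) (s : ℤ), Primrec fun n : ℕ =>
      (n.rec b fun k t => 2 * t + if P (k + 1) = s then 1 else 0 : ℕ) := fun b s =>
    Primrec.nat_rec₁ b (Primrec.nat_add.comp (Primrec.nat_mul.comp (.const 2) .snd)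
      (Primrec.ite (Primrec.eq.comp (hP.comp (Primrec.succ.comp .fst)) (.const s))
        (.const 1) (.const 0)))
  refine (Primrec.nat_sub.comp (haux I.toNat 1) (haux (-I).toNat (-1))).of_eq fun n => ?_
  rw [← Int.toNat_sub]
  congr 1
  induction n with
  | zero => exact Int.toNat_sub_toNat_neg I
  | succ n ih =>
    simp only [signedNum, ← ih]
    push_cast
    rcases hd (n + 1) with h | h | h <;> simp [h] <;> ring

theorem abs_sub_signedNum_le {I : ℤ} {P : ℕ → ℤ} (hd : ∀ i, P i = -1 ∨ P i = 0 ∨ P i = 1) {x : ℝ}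
    (hx : Tendsto (fun n => (signedNum I P n : ℝ) / 2 ^ n) atTop (nhds x)) (n : ℕ) :
    ((signedNum I P n : ℝ) - 1) / 2 ^ n ≤ x ∧ x ≤ ((signedNum I P n : ℝ) + 1) / 2 ^ n := by
  have h0 : Tendsto (fun n : ℕ => 1 / (2 : ℝ) ^ n) atTop (nhds 0) := by
    simpa using tendsto_pow_atTop_nhds_zero_of_lt_one (by norm_num : (0 : ℝ) ≤ 2⁻¹) (by norm_num)
  have hb : ∀ i, -1 ≤ (P i : ℝ) ∧ (P i : ℝ) ≤ 1 := fun i => by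
    rcases hd i with h | h | h <;> norm_num [h]
  constructor
  · refine Monotone.ge_of_tendsto (f := fun n => ((signedNum I P n : ℝ) - 1) / 2 ^ n)
      (monotone_nat_of_le_succ fun k => ?_) (by simpa [sub_div] using hx.sub h0) n
    rw [div_le_div_iff₀ (by positivity) (by positivity), signedNum, pow_succ]
    push_cast
    nlinarith [pow_pos (by norm_num : (0 : ℝ) < 2) k, (hb (k + 1)).1]
  · refine Antitone.le_of_tendsto (f := fun n => ((signedNum I P n : ℝ) + 1) / 2 ^ n)
      (antitone_nat_of_succ_le fun k => ?_) (by simpa [add_div] using hx.add h0) n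
    rw [div_le_div_iff₀ (by positivity) (by positivity), signedNum, pow_succ]
    push_cast
    nlinarith [pow_pos (by norm_num : (0 : ℝ) < 2) k, (hb (k + 1)).2]

theorem not_sprcnRep_of_tendsto_diagSeq {x : ℝ}
    (hx : Tendsto (fun n => (diagSeq n : ℝ)) atTop (nhds x)) : ¬ SPRCNRep x := by
  rintro ⟨I, P, hP, hd, hlim⟩
  simp only [sum_signed_digits_eq] at hlim
  obtain ⟨c, hc⟩ := exists_primEval_eq (Primrec.nat_iff.1 (primrec_toNat_signedNum hP hd I))
  set e := encode c with he
  have hval : primEval (Denumerable.ofNat Code e) (3 * (e + 1)) =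
      (signedNum I P (3 * (e + 1))).toNat := by rw [he, Denumerable.ofNat_encode, hc]
  have hlow : (diagSeq (e + 1) : ℝ) ≤ x := Monotone.ge_of_tendsto
    (fun m n h => Rat.cast_le.2 (diagSeq_monotone h)) hx (e + 1)
  have hup : x ≤ ((diagSeq (e + 1) + 5 / 7 / 8 ^ (e + 1) : ℚ) : ℝ) :=
    le_of_tendsto hx (eventually_atTop.2 ⟨e + 1, fun n h => Rat.cast_le.2 (diagSeq_le_of_le h)⟩)
  obtain ⟨hylow, hyup⟩ := abs_sub_signedNum_le hd hlim (3 * (e + 1))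
  have hpow : (2 : ℝ) ^ (3 * (e + 1)) = 8 ^ (e + 1) := by rw [pow_mul]; norm_num
  rw [hpow] at hylow hyup
  generalize signedNum I P (3 * (e + 1)) = Y at hval hylow hyup
  simp only [diagSeq] at hlow hup
  push_cast at hlow hup
  rw [← add_div] at hup
  have hpos : (0 : ℝ) < 8 ^ (e + 1) := by positivity
  by_cases hlt : Y.toNat < 8 * diagNum e + 3
  · have hnum : diagNum (e + 1) = 8 * diagNum e + 5 := by rw [diagNum, hval, if_pos hlt]
    have h := (div_le_div_iff_of_pos_right hpos).1 (hlow.trans hyup)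
    have : (diagNum (e + 1) : ℤ) ≤ Y + 1 := by exact_mod_cast h
    omega
  · have hnum : diagNum (e + 1) = 8 * diagNum e + 1 := by rw [diagNum, hval, if_neg hlt]
    have h := (div_le_div_iff_of_pos_right hpos).1 (hylow.trans hup)
    have hY : (diagNum (e + 1) : ℤ) + 2 ≤ Y := by omega
    have : (diagNum (e + 1) : ℝ) + 2 ≤ Y := by exact_mod_cast hY
    linarith

theorem stmt_1 :
    ∃ (x : ℝ) (q : ℕ → ℚ), Computable q ∧
      (∀ m n, m ≤ n → |q n - q m| ≤ ((2 : ℚ) ^ m)⁻¹) ∧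
      Tendsto (fun n => (q n : ℝ)) atTop (nhds x) ∧
      ¬ SPRCNRep x := by
  obtain ⟨x, hx⟩ := exists_tendsto_diagSeq
  exact ⟨x, diagSeq, computable_diagSeq, fun m n h => abs_diagSeq_sub_le h, hx,
    not_sprcnRep_of_tendsto_diagSeq hx⟩
end

section
/- There exists a real number that is SPRCN-representable but not PRCN-representable: there exist an integer I and a primitive recursive function P : ℕ → ℤ with values in {-1, 0, 1} whose partial sums I + ∑_{i=1}^n P(i)·2^{−i} converge to a real number x, such that for every integer I′ and every primitive recursive function P′ : ℕ → ℕ with values in {0, 1}, the partial sums I′ + ∑_{i=1}^n P′(i)·2^{−i} do not converge to x. -/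
open Filter

/-- A real number is PRCN-representable if there exist an integer `I` and a primitive
recursive `P : ℕ → ℕ` with values in `{0, 1}` whose partial sums
`I + ∑_{i=1}^n P(i)·2^{−i}` converge to it. -/
def PRCNRep (x : ℝ) : Prop :=
  ∃ (I : ℤ) (P : ℕ → ℕ), Primrec P ∧ (∀ i, P i = 0 ∨ P i = 1) ∧
    Tendsto (fun n => (I : ℝ) + ∑ i ∈ Finset.Icc 1 n, (P i : ℝ) / 2 ^ i)
      atTop (nhds x)

open Nat.Partrec (Code)

namespace SignedDigit

/-- Replace every unbounded search in a code by the zero function. -/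
def dropSearch (c : Code) : Code :=
  Code.recOn c .zero .succ .left .right (fun _ _ f g => .pair f g) (fun _ _ f g => .comp f g)
    (fun _ _ f g => .prec f g) (fun _ _ => .zero)

theorem primrec_dropSearch : Primrec dropSearch := by
  have h3 : Primrec fun a : Code × Code × Code × Code × Code => a.2.2.2.1 :=
    Primrec.fst.comp (Primrec.snd.comp (Primrec.snd.comp Primrec.snd))
  have h4 : Primrec fun a : Code × Code × Code × Code × Code => a.2.2.2.2 :=
    Primrec.snd.comp (Primrec.snd.comp (Primrec.snd.comp Primrec.snd))
  exact Code.primrec_recOn (c := fun c : Code => c) Primrec.id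
    (Primrec.const Code.zero) (Primrec.const Code.succ) (Primrec.const Code.left)
    (Primrec.const Code.right) (pr := fun _ _ _ f g => Code.pair f g)
    (Code.primrec₂_pair.comp h3 h4) (co := fun _ _ _ f g => Code.comp f g)
    (Code.primrec₂_comp.comp h3 h4) (pc := fun _ _ _ f g => Code.prec f g)
    (Code.primrec₂_prec.comp h3 h4) (rf := fun _ _ _ => Code.zero) (Primrec.const Code.zero)

theorem eval_pair_coe {c d : Code} {f g : ℕ → ℕ} (hc : c.eval = f) (hd : d.eval = g) :
    (Code.pair c d).eval = ↑(fun n => Nat.pair (f n) (g n)) := by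
  funext n
  simp [Code.eval, hc, hd, Seq.seq]

theorem eval_comp_coe {c d : Code} {f g : ℕ → ℕ} (hc : c.eval = f) (hd : d.eval = g) :
    (Code.comp c d).eval = ↑(fun n => f (g n)) := by
  funext n
  simp only [Code.eval, hc, hd, PFun.coe_val]
  exact Part.bind_some _ _

theorem eval_prec_coe {c d : Code} {f g : ℕ → ℕ} (hc : c.eval = f) (hd : d.eval = g) :
    (Code.prec c d).eval = (Nat.unpaired fun z n =>
      n.rec (f z) fun y IH => g <| Nat.pair z <| Nat.pair y IH : ℕ → ℕ) := by
  funext n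
  simp only [Code.eval, hc, hd, Nat.unpaired, PFun.coe_val]
  induction n.unpair.2 with
  | zero => rfl
  | succ k ih => exact (congrArg (Part.bind · _) ih).trans (Part.bind_some _ _)

theorem exists_eval_dropSearch (c : Code) : ∃ f : ℕ → ℕ, (dropSearch c).eval = f := by
  induction c with
  | zero => exact ⟨fun _ => 0, rfl⟩
  | succ => exact ⟨_, rfl⟩
  | left => exact ⟨_, rfl⟩
  | right => exact ⟨_, rfl⟩
  | pair c d hc hd =>
    obtain ⟨f, hf⟩ := hc
    obtain ⟨g, hg⟩ := hd
    exact ⟨_, eval_pair_coe hf hg⟩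
  | comp c d hc hd =>
    obtain ⟨f, hf⟩ := hc
    obtain ⟨g, hg⟩ := hd
    exact ⟨_, eval_comp_coe hf hg⟩
  | prec c d hc hd =>
    obtain ⟨f, hf⟩ := hc
    obtain ⟨g, hg⟩ := hd
    exact ⟨_, eval_prec_coe hf hg⟩
  | rfind' c _ => exact ⟨fun _ => 0, rfl⟩

theorem exists_dropSearch_of_primrec {f : ℕ → ℕ} (hf : Nat.Primrec f) :
    ∃ c : Code, (dropSearch c).eval = f := by
  induction hf with
  | zero => exact ⟨.zero, rfl⟩
  | succ => exact ⟨.succ, rfl⟩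
  | left => exact ⟨.left, rfl⟩
  | right => exact ⟨.right, rfl⟩
  | pair _ _ hf hg =>
    obtain ⟨c, hc⟩ := hf
    obtain ⟨d, hd⟩ := hg
    exact ⟨.pair c d, eval_pair_coe hc hd⟩
  | comp _ _ hf hg =>
    obtain ⟨c, hc⟩ := hf
    obtain ⟨d, hd⟩ := hg
    exact ⟨.comp c d, eval_comp_coe hc hd⟩
  | prec _ _ hf hg =>
    obtain ⟨c, hc⟩ := hf
    obtain ⟨d, hd⟩ := hg
    exact ⟨.prec c d, eval_prec_coe hc hd⟩

/-- Run the `s.1`-th primitive recursive function on input `s.2` for `i` steps. -/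
def run (i : ℕ) (s : ℕ × ℕ) : Option ℕ :=
  (dropSearch (Denumerable.ofNat Code s.1)).evaln i s.2

theorem primrec_run : Primrec₂ run :=
  Code.primrec_evaln.comp <| Primrec.pair
    (Primrec.pair Primrec.fst (primrec_dropSearch.comp
      ((Primrec.ofNat Code).comp (Primrec.fst.comp Primrec.snd))))
    (Primrec.snd.comp Primrec.snd)

/-- The state before digit `i` is chosen: the index of the primitive recursive function that is
being diagonalized against, and the position at which it will be wrong. -/
def state : ℕ → ℕ × ℕ :=
  Nat.rec (0, 1) fun i s => Option.casesOn (run i s) s fun _ => (s.1 + 1, i + 1)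

theorem primrec_state : Primrec state := by
  refine Primrec.nat_rec₁ _ ?_
  refine Primrec.option_casesOn (o := fun p : ℕ × ℕ × ℕ => run p.1 p.2) primrec_run Primrec.snd ?_
  exact Primrec.pair (Primrec.succ.comp (Primrec.fst.comp (Primrec.snd.comp Primrec.fst)))
    (Primrec.succ.comp (Primrec.fst.comp Primrec.fst))

theorem state_succ_of_none {i : ℕ} (h : run i (state i) = none) : state (i + 1) = state i := by
  simp only [state] at h ⊢
  rw [h]

theorem state_succ_of_some {i v : ℕ} (h : run i (state i) = some v) :
    state (i + 1) = ((state i).1 + 1, i + 1) := by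
  simp only [state] at h ⊢
  rw [h]

/-- The digits of a signed binary expansion that differs from all primitive recursive binary
expansions. -/
def digit (i : ℕ) : ℤ :=
  Option.casesOn (run i (state i)) 0 fun v => if v = 0 then -1 else 1

theorem primrec_digit : Primrec digit := by
  refine Primrec.option_casesOn (o := fun i => run i (state i))
    (primrec_run.comp Primrec.id primrec_state) (Primrec.const 0) ?_
  exact Primrec.ite (Primrec.eq.comp Primrec.snd (Primrec.const 0)) (Primrec.const (-1))
    (Primrec.const 1)

theorem digit_of_none {i : ℕ} (h : run i (state i) = none) : digit i = 0 := by
  simp [digit, h]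

theorem digit_of_some {i v : ℕ} (h : run i (state i) = some v) :
    digit i = if v = 0 then -1 else 1 := by
  simp [digit, h]

theorem digit_trichotomy (i : ℕ) : digit i = -1 ∨ digit i = 0 ∨ digit i = 1 := by
  cases h : run i (state i) with
  | none => simp [digit_of_none h]
  | some v => rw [digit_of_some h]; split_ifs <;> simp

theorem lt_of_run_eq_some {i v : ℕ} {s : ℕ × ℕ} (h : run i s = some v) : s.2 < i :=
  Code.evaln_bound h

theorem one_le_state_snd (i : ℕ) : 1 ≤ (state i).2 := by
  induction i with
  | zero => exact le_rfl
  | succ i ih =>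
    cases h : run i (state i) with
    | none => rwa [state_succ_of_none h]
    | some v => simp [state_succ_of_some h]

theorem digit_eq_zero_of_state_snd_le {i j : ℕ} (hj : (state i).2 ≤ j) (hji : j < i) :
    digit j = 0 := by
  induction i with
  | zero => omega
  | succ i ih =>
    cases h : run i (state i) with
    | none =>
      rw [state_succ_of_none h] at hj
      rcases Nat.lt_succ_iff_lt_or_eq.1 hji with h' | rfl
      · exact ih hj h'
      · exact digit_of_none h
    | some v =>
      rw [state_succ_of_some h] at hj
      simp only at hj
      omega

theorem digit_succ_eq_zero {i v : ℕ} (h : run i (state i) = some v) : digit (i + 1) = 0 := by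
  refine digit_of_none (Option.eq_none_iff_forall_not_mem.2 fun w hw => ?_)
  have := lt_of_run_eq_some hw
  rw [state_succ_of_some h] at this
  exact lt_irrefl _ this

theorem exists_run_eq_some_of_state {e i : ℕ} (hi : (state i).1 = e) :
    ∃ j v, (state j).1 = e ∧ run j (state j) = some v := by
  by_contra! hne
  have hstate : ∀ k, state (i + k) = state i := by
    intro k
    induction k with
    | zero => rfl
    | succ k ih =>
      rw [← add_assoc, state_succ_of_none, ih]
      exact Option.eq_none_iff_forall_ne_some.2 fun v => hne _ v (by rw [ih, hi])
  obtain ⟨f, hf⟩ := exists_eval_dropSearch (Denumerable.ofNat Code e)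
  obtain ⟨k, hk⟩ := Code.evaln_complete.1
    (show f (state i).2 ∈ (dropSearch (Denumerable.ofNat Code e)).eval (state i).2 by simp [hf])
  refine hne (i + k) (f (state i).2) (by rw [hstate, hi]) ?_
  rw [hstate, run, hi]
  exact Code.evaln_mono (Nat.le_add_left k i) hk

theorem exists_run_eq_some (e : ℕ) : ∃ j v, (state j).1 = e ∧ run j (state j) = some v := by
  induction e with
  | zero => exact exists_run_eq_some_of_state (i := 0) rfl
  | succ e ih =>
    obtain ⟨j, v, hj, hv⟩ := ih
    exact exists_run_eq_some_of_state (i := j + 1) (by rw [state_succ_of_some hv, hj])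

theorem exists_run_eq_of_primrec {f : ℕ → ℕ} (hf : Nat.Primrec f) :
    ∃ j, run j (state j) = some (f (state j).2) := by
  obtain ⟨c, hc⟩ := exists_dropSearch_of_primrec hf
  obtain ⟨j, v, hj, hv⟩ := exists_run_eq_some (Encodable.encode c)
  have hmem : v ∈ (dropSearch (Denumerable.ofNat Code (state j).1)).eval (state j).2 :=
    Code.evaln_sound hv
  rw [hj, Denumerable.ofNat_encode, hc] at hmem
  refine ⟨j, hv.trans ?_⟩
  simpa [eq_comm] using hmem

section Expansion

variable {d : ℕ → ℝ} {x : ℝ}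

theorem abs_sum_Icc_sub_sum_Icc_le (hd : ∀ i, |d i| ≤ 1) (m k : ℕ) :
    |∑ i ∈ Finset.Icc 1 (m + k), d i / 2 ^ i - ∑ i ∈ Finset.Icc 1 m, d i / 2 ^ i| ≤
      1 / 2 ^ m - 1 / 2 ^ (m + k) := by
  induction k with
  | zero => simp
  | succ k ih =>
    rw [← add_assoc, Finset.sum_Icc_succ_top (by omega)]
    have h : |d (m + k + 1) / 2 ^ (m + k + 1)| ≤ 1 / 2 ^ (m + k + 1) := by
      rw [abs_div, abs_of_pos (by positivity : (0 : ℝ) < 2 ^ (m + k + 1))]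
      gcongr
      exact hd _
    have h2 : (1 : ℝ) / 2 ^ (m + k) = 1 / 2 ^ (m + k + 1) + 1 / 2 ^ (m + k + 1) := by
      rw [pow_succ]
      field_simp
      norm_num
    rw [abs_le] at *
    constructor <;> linarith [ih.1, ih.2, h.1, h.2]

theorem exists_tendsto_sum_Icc (hd : ∀ i, |d i| ≤ 1) :
    ∃ x, Tendsto (fun n => ∑ i ∈ Finset.Icc 1 n, d i / 2 ^ i) atTop (nhds x) := by
  refine cauchySeq_tendsto_of_complete (cauchySeq_of_le_geometric_two (C := 1) fun n => ?_)
  rw [dist_comm, Real.dist_eq]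
  refine (abs_sum_Icc_sub_sum_Icc_le hd n 1).trans (le_of_eq ?_)
  rw [pow_succ]
  field_simp
  norm_num

theorem abs_sub_sum_Icc_le (hd : ∀ i, |d i| ≤ 1)
    (hx : Tendsto (fun n => ∑ i ∈ Finset.Icc 1 n, d i / 2 ^ i) atTop (nhds x)) (m : ℕ) :
    |x - ∑ i ∈ Finset.Icc 1 m, d i / 2 ^ i| ≤ 1 / 2 ^ m := by
  refine le_of_tendsto (hx.sub_const _).abs ?_
  filter_upwards [eventually_ge_atTop m] with n hn
  obtain ⟨k, rfl⟩ := Nat.exists_eq_add_of_le hn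
  refine (abs_sum_Icc_sub_sum_Icc_le hd m k).trans ?_
  linarith [show (0 : ℝ) ≤ 1 / 2 ^ (m + k) by positivity]

theorem sum_Icc_le_of_tendsto (hd : ∀ i, 0 ≤ d i)
    (hx : Tendsto (fun n => ∑ i ∈ Finset.Icc 1 n, d i / 2 ^ i) atTop (nhds x)) (m : ℕ) :
    ∑ i ∈ Finset.Icc 1 m, d i / 2 ^ i ≤ x := by
  refine ge_of_tendsto hx ?_
  filter_upwards [eventually_ge_atTop m] with n hn
  exact Finset.sum_le_sum_of_subset_of_nonneg (Finset.Icc_subset_Icc_right hn)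
    fun i _ _ => div_nonneg (hd i) (by positivity)

theorem exists_sum_Icc_mul_two_pow_eq (a : ℕ → ℤ) (m : ℕ) :
    ∃ N : ℤ, (∑ i ∈ Finset.Icc 1 m, (a i : ℝ) / 2 ^ i) * 2 ^ m = N := by
  induction m with
  | zero => exact ⟨0, by simp⟩
  | succ m ih =>
    obtain ⟨N, hN⟩ := ih
    refine ⟨2 * N + a (m + 1), ?_⟩
    rw [Finset.sum_Icc_succ_top (by omega), add_mul, pow_succ, ← mul_assoc, hN]
    push_cast
    field_simp

theorem sum_Icc_eq_of_eq_zero {m n : ℕ} (hmn : m ≤ n) (h : ∀ i, m < i → i ≤ n → d i = 0) :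
    ∑ i ∈ Finset.Icc 1 n, d i / 2 ^ i = ∑ i ∈ Finset.Icc 1 m, d i / 2 ^ i := by
  refine (Finset.sum_subset (Finset.Icc_subset_Icc_right hmn) fun i hi hi' => ?_).symm
  rw [Finset.mem_Icc] at hi hi'
  rw [h i (by omega) hi.2, zero_div]

/-- If the digits of `x` at positions `m + 1, …, m + k + 1` vanish and are followed by a digit `s`
and a zero, then up to an even integer `x * 2 ^ (m + 1)` is a nonzero number of absolute value less
than one and of the same sign as `s`. -/
theorem exists_mul_two_pow_eq_of_digits (a : ℕ → ℤ) (ha : ∀ i, |(a i : ℝ)| ≤ 1)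
    (hx : Tendsto (fun n => ∑ i ∈ Finset.Icc 1 n, (a i : ℝ) / 2 ^ i) atTop (nhds x))
    {m q : ℕ} (hmq : m + 1 < q) (h0 : ∀ i, m < i → i < q → a i = 0) (h1 : a (q + 1) = 0)
    (hq : |(a q : ℝ)| = 1) :
    ∃ (N : ℤ) (δ : ℝ), x * 2 ^ (m + 1) = 2 * N + a q * δ ∧ 0 < δ ∧ δ < 1 := by
  obtain ⟨N, hN⟩ := exists_sum_Icc_mul_two_pow_eq a m
  obtain ⟨r, rfl⟩ : ∃ r, q = m + 1 + r + 1 := ⟨q - (m + 2), by omega⟩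
  have htail := abs_sub_sum_Icc_le ha hx (m + 1 + r + 1 + 1)
  rw [Finset.sum_Icc_succ_top (by omega), h1, Finset.sum_Icc_succ_top (by omega),
    sum_Icc_eq_of_eq_zero (m := m) (by omega)
      fun i hi hi' => by exact_mod_cast h0 i hi (by omega)] at htail
  set A := ∑ i ∈ Finset.Icc 1 m, (a i : ℝ) / 2 ^ i
  set s : ℝ := (a (m + 1 + r + 1) : ℝ)
  have hs : s * s = 1 := by rw [← abs_mul_abs_self, hq, one_mul]
  refine ⟨N, s * ((x - A) * 2 ^ (m + 1)), ?_, ?_⟩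
  · rw [← mul_assoc, hs, ← hN]
    ring
  · have hr : (1 : ℝ) ≤ 2 ^ r := one_le_pow₀ (by norm_num)
    have hpos : (0 : ℝ) < 2 ^ (m + 1) := by positivity
    have key : |(x - A) * 2 ^ (m + 1) - s * (1 / (2 * 2 ^ r))| ≤ 1 / (4 * 2 ^ r) := by
      have hp1 : (2 : ℝ) ^ (m + 1 + r + 1) = 2 ^ (m + 1) * (2 * 2 ^ r) := by ring
      have hp2 : (2 : ℝ) ^ (m + 1 + r + 1 + 1) = 2 ^ (m + 1) * (4 * 2 ^ r) := by ring
      rw [hp2, hp1, Int.cast_zero, zero_div, add_zero] at htail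
      have := mul_le_mul_of_nonneg_right htail hpos.le
      nth_rewrite 2 [← abs_of_pos hpos] at this
      rw [← abs_mul] at this
      generalize (2 : ℝ) ^ (m + 1) = c at hpos this ⊢
      refine (le_of_eq (congrArg _ ?_)).trans (this.trans (le_of_eq ?_))
      · field_simp
        ring
      · field_simp
    have e1 : (1 : ℝ) / (2 * 2 ^ r) = 1 / 2 * (2 ^ r)⁻¹ := by field_simp
    have e2 : (1 : ℝ) / (4 * 2 ^ r) = 1 / 4 * (2 ^ r)⁻¹ := by field_simp
    have hi0 : (0 : ℝ) < (2 ^ r)⁻¹ := by positivity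
    have hi1 : ((2 : ℝ) ^ r)⁻¹ ≤ 1 := inv_le_one_of_one_le₀ hr
    rw [e1, e2, abs_le] at key
    rcases mul_self_eq_one_iff.1 hs with h | h <;> rw [h] at key ⊢ <;> constructor <;>
      linarith [key.1, key.2]

theorem exists_mul_two_pow_eq_of_binary (I : ℤ) (b : ℕ → ℕ) (hb : ∀ i, b i = 0 ∨ b i = 1)
    (hx : Tendsto (fun n => (I : ℝ) + ∑ i ∈ Finset.Icc 1 n, (b i : ℝ) / 2 ^ i) atTop (nhds x))
    (m : ℕ) :
    ∃ (M : ℤ) (τ : ℝ), x * 2 ^ (m + 1) = 2 * M + b (m + 1) + τ ∧ 0 ≤ τ ∧ τ ≤ 1 := by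
  have hx' : Tendsto (fun n => ∑ i ∈ Finset.Icc 1 n, (b i : ℝ) / 2 ^ i) atTop (nhds (x - I)) := by
    simpa using hx.sub_const (I : ℝ)
  have hb0 : ∀ i, (0 : ℝ) ≤ b i := fun i => Nat.cast_nonneg _
  have hb1 : ∀ i, |(b i : ℝ)| ≤ 1 := fun i => by rcases hb i with h | h <;> simp [h]
  obtain ⟨N, hN⟩ := exists_sum_Icc_mul_two_pow_eq (fun i => b i) m
  have hlow := sum_Icc_le_of_tendsto hb0 hx' (m + 1)
  have hupp := (abs_le.1 (abs_sub_sum_Icc_le hb1 hx' (m + 1))).2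
  have hsum : (∑ i ∈ Finset.Icc 1 (m + 1), (b i : ℝ) / 2 ^ i) * 2 ^ (m + 1) =
      2 * N + b (m + 1) := by
    rw [Finset.sum_Icc_succ_top (by omega), add_mul, pow_succ, ← mul_assoc, ← hN]
    push_cast
    field_simp
  have hpos : (0 : ℝ) < 2 ^ (m + 1) := by positivity
  refine ⟨N + I * 2 ^ m,
    (x - I - ∑ i ∈ Finset.Icc 1 (m + 1), (b i : ℝ) / 2 ^ i) * 2 ^ (m + 1), ?_, ?_, ?_⟩
  · rw [sub_mul _ _ ((2 : ℝ) ^ (m + 1)), hsum]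
    push_cast
    ring
  · exact mul_nonneg (by linarith) hpos.le
  · rwa [← le_div_iff₀ hpos]

end Expansion

theorem abs_digit_le_one (i : ℕ) : |(digit i : ℝ)| ≤ 1 := by
  rcases digit_trichotomy i with h | h | h <;> simp [h]

theorem not_pRCNRep_of_tendsto_digit {x : ℝ}
    (hx : Tendsto (fun n => ∑ i ∈ Finset.Icc 1 n, (digit i : ℝ) / 2 ^ i) atTop (nhds x)) :
    ¬ PRCNRep x := by
  rintro ⟨I, b, hb, hb01, hbx⟩
  obtain ⟨q, hq⟩ := exists_run_eq_of_primrec (Primrec.nat_iff.1 hb)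
  obtain ⟨m, hm⟩ := Nat.exists_eq_add_of_le' (one_le_state_snd q)
  have hlt := lt_of_run_eq_some hq
  have hdigit := digit_of_some hq
  rw [hm] at hlt hdigit
  obtain ⟨N, δ, hxN, hδ0, hδ1⟩ := exists_mul_two_pow_eq_of_digits digit abs_digit_le_one hx hlt
    (fun i hi hiq => digit_eq_zero_of_state_snd_le (by omega) hiq) (digit_succ_eq_zero hq)
    (by rw [hdigit]; split_ifs <;> simp)
  obtain ⟨M, τ, hxM, hτ0, hτ1⟩ := exists_mul_two_pow_eq_of_binary I b hb01 hbx m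
  rw [hxN, hdigit] at hxM
  have hodd : ∀ z : ℝ, (2 : ℝ) * (N - M) = z → 0 < z → z < 2 → False := by
    intro z hz h0 h2
    have hlow : (0 : ℝ) < (N - M : ℤ) := by push_cast; linarith
    have hupp : ((N - M : ℤ) : ℝ) < (1 : ℤ) := by push_cast; linarith
    have := Int.cast_pos.1 hlow
    have := Int.cast_lt.1 hupp
    omega
  rcases hb01 (m + 1) with h | h <;> simp only [h] at hxM <;> norm_num at hxM
  · exact hodd (τ + δ) (by linarith) (by linarith) (by linarith)
  · exact hodd (1 + τ - δ) (by linarith) (by linarith) (by linarith)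

end SignedDigit

theorem stmt_3 : ∃ x : ℝ, SPRCNRep x ∧ ¬ PRCNRep x := by
  obtain ⟨x, hx⟩ := SignedDigit.exists_tendsto_sum_Icc SignedDigit.abs_digit_le_one
  exact ⟨x, ⟨0, SignedDigit.digit, SignedDigit.primrec_digit, SignedDigit.digit_trichotomy,
    by simpa using hx⟩, SignedDigit.not_pRCNRep_of_tendsto_digit hx⟩
end

section
/- The real number √2 is SPRCN-representable: there exist an integer I and a primitive recursive function P : ℕ → ℤ with values in {-1, 0, 1} such that the partial sums I + ∑_{i=1}^n P(i)·2^{−i} converge to √2. -/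
open Filter

theorem Nat.sqrt_four_mul (k : ℕ) : Nat.sqrt (4 * k) = 2 * Nat.sqrt k + Nat.sqrt (4 * k) % 2 := by
  have h₁ := Nat.sqrt_le k
  have h₂ := Nat.lt_succ_sqrt k
  rw [Nat.succ_eq_add_one] at h₂
  have h₃ : 2 * Nat.sqrt k ≤ Nat.sqrt (4 * k) := Nat.le_sqrt.2 (by nlinarith)
  have h₄ : Nat.sqrt (4 * k) < 2 * Nat.sqrt k + 2 := Nat.sqrt_lt.2 (by nlinarith)
  omega

theorem sqrt_natCast_partial_sum (m n : ℕ) :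
    ((Nat.sqrt m : ℤ) : ℝ) +
      ∑ i ∈ Finset.Icc 1 n, ((if Nat.sqrt (m * 4 ^ i) % 2 = 1 then 1 else 0 : ℤ) : ℝ) / 2 ^ i =
      (Nat.sqrt (m * 4 ^ n) : ℝ) / 2 ^ n := by
  induction n with
  | zero => simp
  | succ n ih =>
    rw [Finset.sum_Icc_succ_top (by omega), ← add_assoc, ih]
    have h : Nat.sqrt (m * 4 ^ (n + 1)) =
        2 * Nat.sqrt (m * 4 ^ n) + Nat.sqrt (m * 4 ^ (n + 1)) % 2 := by
      have := Nat.sqrt_four_mul (m * 4 ^ n)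
      rwa [show 4 * (m * 4 ^ n) = m * 4 ^ (n + 1) by ring] at this
    rw [pow_succ (2 : ℝ) n]
    rcases Nat.mod_two_eq_zero_or_one (Nat.sqrt (m * 4 ^ (n + 1))) with h₀ | h₀ <;>
    · rw [h₀] at h ⊢
      rw [h]
      push_cast
      simp
      field_simp

theorem tendsto_natSqrt_mul_four_pow_div (m : ℕ) :
    Tendsto (fun n : ℕ => (Nat.sqrt (m * 4 ^ n) : ℝ) / 2 ^ n) atTop (nhds (Real.sqrt m)) := by
  have hs (n : ℕ) : Real.sqrt ((m * 4 ^ n : ℕ) : ℝ) = Real.sqrt m * 2 ^ n := by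
    push_cast
    rw [Real.sqrt_mul (Nat.cast_nonneg m), show (4 : ℝ) ^ n = (2 ^ n) ^ 2 by
      rw [← pow_mul, mul_comm, pow_mul]; norm_num, Real.sqrt_sq (by positivity)]
  have hl : Tendsto (fun n : ℕ => Real.sqrt m - (1 / 2 : ℝ) ^ n) atTop (nhds (Real.sqrt m)) := by
    simpa using tendsto_const_nhds.sub
      (tendsto_pow_atTop_nhds_zero_of_lt_one (r := (1 / 2 : ℝ)) (by norm_num) (by norm_num))
  refine tendsto_of_tendsto_of_tendsto_of_le_of_le hl tendsto_const_nhds (fun n => ?_) fun n => ?_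
  · have h := Real.real_sqrt_lt_nat_sqrt_succ (a := m * 4 ^ n)
    rw [hs] at h
    have h2 : (1 / 2 : ℝ) ^ n * 2 ^ n = 1 := by rw [← mul_pow]; norm_num
    show _ ≤ (_ : ℝ) / _
    rw [le_div_iff₀ (by positivity), sub_mul, h2]
    linarith
  · have h := Real.nat_sqrt_le_real_sqrt (a := m * 4 ^ n)
    rw [hs] at h
    exact (div_le_iff₀ (by positivity)).2 h

theorem sprcnRep_sqrt_natCast (m : ℕ) : SPRCNRep (Real.sqrt m) := by
  refine ⟨Nat.sqrt m, fun i => if Nat.sqrt (m * 4 ^ i) % 2 = 1 then 1 else 0, ?_, fun i => ?_, ?_⟩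
  · have h : Primrec fun i : ℕ => Nat.sqrt (m * 4 ^ i) % 2 :=
      Primrec.nat_mod.comp
        (Primrec.nat_sqrt.comp (Primrec.nat_mul.comp (Primrec.const m)
          (Primrec.nat_pow.comp (Primrec.const 4) Primrec.id))) (Primrec.const 2)
    exact Primrec.ite (Primrec.eq.comp h (Primrec.const 1)) (Primrec.const 1) (Primrec.const 0)
  · dsimp only
    split_ifs <;> simp
  · simpa only [sqrt_natCast_partial_sum] using tendsto_natSqrt_mul_four_pow_div m

theorem stmt_5 : SPRCNRep (Real.sqrt 2) := by
  exact_mod_cast sprcnRep_sqrt_natCast 2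
end

section
/- The real number π is SPRCN-representable: there exist an integer I and a primitive recursive function P : ℕ → ℤ with values in {-1, 0, 1} such that the partial sums I + ∑_{i=1}^n P(i)·2^{−i} converge to π. -/
open Filter

/-- The numerator of the signed-digit partial sum over the denominator `2 ^ n`, steered by
approximations `q n` of `2 ^ n * x`. -/
def signedNumerator (q : ℕ → ℕ) : ℕ → ℕ
  | 0 => q 0
  | n + 1 =>
    if 2 * signedNumerator q n < q (n + 1) then 2 * signedNumerator q n + 1
    else if q (n + 1) < 2 * signedNumerator q n then 2 * signedNumerator q n - 1
    else 2 * signedNumerator q n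

/-- The signed digit that leads from one `signedNumerator` to the next. -/
def signedDigit (q : ℕ → ℕ) (i : ℕ) : ℤ :=
  if 2 * signedNumerator q (i - 1) < q i then 1
  else if q i < 2 * signedNumerator q (i - 1) then -1
  else 0

theorem primrec_signedNumerator {q : ℕ → ℕ} (hq : Primrec q) :
    Primrec (signedNumerator q) := by
  have hd : Primrec fun p : ℕ × ℕ => 2 * p.2 :=
    Primrec.nat_mul.comp (Primrec.const 2) Primrec.snd
  have hs : Primrec fun p : ℕ × ℕ => q (p.1 + 1) :=
    hq.comp (Primrec.succ.comp Primrec.fst)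
  have hstep : Primrec₂ fun n s : ℕ =>
      if 2 * s < q (n + 1) then 2 * s + 1
      else if q (n + 1) < 2 * s then 2 * s - 1 else 2 * s :=
    Primrec.ite (Primrec.nat_lt.comp hd hs) (Primrec.succ.comp hd)
      (Primrec.ite (Primrec.nat_lt.comp hs hd) (Primrec.pred.comp hd) hd)
  refine (Primrec.nat_rec₁ (q 0) hstep).of_eq fun n => ?_
  induction n with
  | zero => rfl
  | succ n ih => simp only [ih, signedNumerator]

theorem primrec_signedDigit {q : ℕ → ℕ} (hq : Primrec q) : Primrec (signedDigit q) := by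
  have hd : Primrec fun i : ℕ => 2 * signedNumerator q (i - 1) :=
    Primrec.nat_mul.comp (Primrec.const 2) ((primrec_signedNumerator hq).comp Primrec.pred)
  exact Primrec.ite (Primrec.nat_lt.comp hd hq) (Primrec.const 1)
    (Primrec.ite (Primrec.nat_lt.comp hq hd) (Primrec.const (-1)) (Primrec.const 0))

theorem abs_signedNumerator_sub_le {q : ℕ → ℕ} {x : ℝ} (hx : 1 < x)
    (h : ∀ n, |(q n : ℝ) - 2 ^ n * x| ≤ 1) (n : ℕ) :
    |(signedNumerator q n : ℝ) - 2 ^ n * x| ≤ 1 := by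
  induction n with
  | zero => exact h 0
  | succ n ih =>
    have hn := h (n + 1)
    rw [abs_le] at ih hn ⊢
    have hp : (1 : ℝ) ≤ 2 ^ n := one_le_pow₀ (by norm_num)
    have hpos : 0 < signedNumerator q n := by
      have : (0 : ℝ) < signedNumerator q n := by nlinarith
      exact_mod_cast this
    rw [pow_succ] at hn ⊢
    simp only [signedNumerator]
    split_ifs with h1 h2
    · have h1' : (2 * signedNumerator q n + 1 : ℝ) ≤ q (n + 1) := by exact_mod_cast h1
      push_cast
      constructor <;> linarith
    · have h2' : (q (n + 1) + 1 : ℝ) ≤ 2 * signedNumerator q n := by exact_mod_cast h2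
      rw [Nat.cast_sub (by omega)]
      push_cast
      constructor <;> linarith
    · have h3 : q (n + 1) = 2 * signedNumerator q n := by omega
      rw [← h3]
      exact hn

theorem sum_signedDigit {q : ℕ → ℕ} (hpos : ∀ n, 0 < signedNumerator q n) (n : ℕ) :
    ((q 0 : ℤ) : ℝ) + ∑ i ∈ Finset.Icc 1 n, (signedDigit q i : ℝ) / 2 ^ i =
      signedNumerator q n / 2 ^ n := by
  induction n with
  | zero => simp [signedNumerator]
  | succ n ih =>
    have hstep : (signedNumerator q (n + 1) : ℝ) =
        2 * signedNumerator q n + signedDigit q (n + 1) := by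
      have := hpos n
      simp only [signedNumerator, signedDigit, Nat.add_sub_cancel]
      split_ifs
      · push_cast; ring
      · rw [Nat.cast_sub (by omega)]
        push_cast
        ring
      · push_cast; ring
    rw [Finset.sum_Icc_succ_top (by omega), ← add_assoc, ih, hstep, pow_succ]
    field_simp

/-- A real number whose binary scalings have primitive recursive integer approximations with error
at most one is SPRCN-representable. -/
theorem sprcnRep_of_primrec_approx {q : ℕ → ℕ} {x : ℝ} (hx : 1 < x) (hq : Primrec q)
    (h : ∀ n, |(q n : ℝ) - 2 ^ n * x| ≤ 1) : SPRCNRep x := by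
  have hS := abs_signedNumerator_sub_le hx h
  have hpos : ∀ n, 0 < signedNumerator q n := fun n => by
    have hp : (1 : ℝ) ≤ 2 ^ n := one_le_pow₀ (by norm_num)
    have := (abs_le.1 (hS n)).1
    have : (0 : ℝ) < signedNumerator q n := by nlinarith
    exact_mod_cast this
  refine ⟨q 0, signedDigit q, primrec_signedDigit hq, fun i => ?_, ?_⟩
  · unfold signedDigit
    split_ifs <;> simp
  · simp only [sum_signedDigit hpos]
    rw [tendsto_iff_dist_tendsto_zero]
    refine squeeze_zero (fun _ => dist_nonneg) (fun n => ?_)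
      (tendsto_pow_atTop_nhds_zero_of_lt_one (r := (1 / 2 : ℝ)) (by norm_num) (by norm_num))
    have hp : (0 : ℝ) < 2 ^ n := by positivity
    rw [Real.dist_eq, one_div, inv_pow, ← one_div, le_div_iff₀ hp, ← abs_of_pos hp, ← abs_mul,
      abs_of_pos hp, sub_mul, div_mul_cancel₀ _ hp.ne', mul_comm x]
    exact hS n

theorem primrec_prod_range {f : ℕ → ℕ} (hf : Primrec f) :
    Primrec fun n => ∏ i ∈ Finset.range n, f i := by
  have hstep : Primrec₂ fun n s : ℕ => s * f n :=
    Primrec.nat_mul.comp Primrec.snd (hf.comp Primrec.fst)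
  refine (Primrec.nat_rec₁ 1 hstep).of_eq fun n => ?_
  induction n with
  | zero => rfl
  | succ n ih => simp only [ih, Finset.prod_range_succ]

/-- The numerator of the Wallis product. -/
def wallisNum (k : ℕ) : ℕ := ∏ i ∈ Finset.range k, (2 * i + 2) * (2 * i + 2)

/-- The denominator of the Wallis product. -/
def wallisDen (k : ℕ) : ℕ := ∏ i ∈ Finset.range k, (2 * i + 1) * (2 * i + 3)

theorem wallis_eq_div (k : ℕ) : Real.Wallis.W k = wallisNum k / wallisDen k := by
  simp only [Real.Wallis.W, wallisNum, wallisDen, Nat.cast_prod, ← Finset.prod_div_distrib]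
  refine Finset.prod_congr rfl fun i _ => ?_
  push_cast
  rw [div_mul_div_comm]

/-- Approximation of `2 ^ n * π` by the Wallis product with `2 ^ (n + 1)` factors. -/
def wallisApprox (n : ℕ) : ℕ :=
  2 ^ (n + 1) * wallisNum (2 ^ (n + 1)) / wallisDen (2 ^ (n + 1)) + 1

theorem primrec_wallisApprox : Primrec wallisApprox := by
  have hlin : ∀ c, Primrec fun i : ℕ => 2 * i + c := fun c =>
    Primrec.nat_add.comp (Primrec.nat_mul.comp (Primrec.const 2) Primrec.id) (Primrec.const c)
  have hnum : Primrec wallisNum := primrec_prod_range (Primrec.nat_mul.comp (hlin 2) (hlin 2))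
  have hden : Primrec wallisDen := primrec_prod_range (Primrec.nat_mul.comp (hlin 1) (hlin 3))
  have hpow : Primrec fun n : ℕ => 2 ^ (n + 1) :=
    (Primrec₂.unpaired'.1 Nat.Primrec.pow).comp (Primrec.const 2) Primrec.succ
  exact Primrec.succ.comp
    (Primrec.nat_div.comp (Primrec.nat_mul.comp hpow (hnum.comp hpow)) (hden.comp hpow))

theorem abs_wallisApprox_sub_le (n : ℕ) : |(wallisApprox n : ℝ) - 2 ^ n * Real.pi| ≤ 1 := by
  have hden : (0 : ℝ) < wallisDen (2 ^ (n + 1)) := by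
    unfold wallisDen
    positivity
  have hle := Real.Wallis.W_le (2 ^ (n + 1))
  have hge := Real.Wallis.le_W (2 ^ (n + 1))
  have hp : (0 : ℝ) < 2 ^ n := by positivity
  have hge' : 2 ^ n * Real.pi - 1 ≤ 2 ^ (n + 1) * Real.Wallis.W (2 ^ (n + 1)) := by
    refine le_trans ?_ (mul_le_mul_of_nonneg_left hge (by positivity))
    push_cast
    rw [pow_succ]
    generalize (2 : ℝ) ^ n = p at hp
    rw [← sub_nonneg]
    have : p * 2 * ((2 * (p * 2) + 1) / (2 * (p * 2) + 2) * (Real.pi / 2)) - (p * Real.pi - 1) =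
        (4 * p + 2 - p * Real.pi) / (4 * p + 2) := by
      field_simp
      ring
    rw [this]
    have := Real.pi_lt_four
    exact div_nonneg (by nlinarith) (by positivity)
  have hle' : 2 ^ (n + 1) * Real.Wallis.W (2 ^ (n + 1)) ≤ 2 ^ n * Real.pi := by
    have := mul_le_mul_of_nonneg_left hle (show (0 : ℝ) ≤ 2 ^ (n + 1) by positivity)
    rw [pow_succ (2 : ℝ)] at this ⊢
    linarith
  have hval : (2 : ℝ) ^ (n + 1) * Real.Wallis.W (2 ^ (n + 1)) =
      ((2 ^ (n + 1) * wallisNum (2 ^ (n + 1)) : ℕ) : ℝ) / wallisDen (2 ^ (n + 1)) := by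
    rw [wallis_eq_div]
    push_cast
    ring
  rw [hval] at hge' hle'
  have hfloor := Nat.cast_div_le (α := ℝ) (m := 2 ^ (n + 1) * wallisNum (2 ^ (n + 1)))
    (n := wallisDen (2 ^ (n + 1)))
  have hceil : ((2 ^ (n + 1) * wallisNum (2 ^ (n + 1)) : ℕ) : ℝ) / wallisDen (2 ^ (n + 1)) ≤
      wallisApprox n := by
    rw [div_le_iff₀ hden]
    have := Nat.lt_div_mul_add (a := 2 ^ (n + 1) * wallisNum (2 ^ (n + 1)))
      (b := wallisDen (2 ^ (n + 1))) (by exact_mod_cast hden)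
    have : 2 ^ (n + 1) * wallisNum (2 ^ (n + 1)) ≤
        wallisApprox n * wallisDen (2 ^ (n + 1)) := by
      rw [wallisApprox, add_mul, one_mul]
      exact this.le
    exact_mod_cast this
  have happrox : (wallisApprox n : ℝ) = ((2 ^ (n + 1) * wallisNum (2 ^ (n + 1)) /
      wallisDen (2 ^ (n + 1)) : ℕ) : ℝ) + 1 := by
    rw [wallisApprox, Nat.cast_succ]
  rw [abs_le]
  constructor <;> linarith

theorem stmt_6 : SPRCNRep Real.pi :=
  sprcnRep_of_primrec_approx (by linarith [Real.pi_gt_three]) primrec_wallisApprox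
    abs_wallisApprox_sub_le
end

section
/- The SPRCN-representable real numbers are closed under multiplication: if x and y are SPRCN-representable real numbers, then x · y is SPRCN-representable. -/
open Filter

theorem Primrec.int_toSum : Primrec Equiv.intEquivNatSumNat := by
  refine Primrec.encode_iff.1 (Primrec.encode.of_eq fun z => ?_)
  cases z <;> rfl

theorem Primrec.int_ofNat : Primrec Int.ofNat :=
  Primrec.encode_iff.1 (Primrec.nat_double.of_eq fun _ => rfl)

theorem Primrec.int_negSucc : Primrec Int.negSucc :=
  Primrec.encode_iff.1 (Primrec.nat_double_succ.of_eq fun _ => rfl)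

theorem Primrec₂.int_subNatNat : Primrec₂ Int.subNatNat :=
  (Primrec.nat_casesOn (f := fun p : ℕ × ℕ => p.2 - p.1)
    (Primrec.nat_sub.comp Primrec.snd Primrec.fst)
    (Primrec.int_ofNat.comp (Primrec.nat_sub.comp Primrec.fst Primrec.snd))
    (Primrec.int_negSucc.comp₂ Primrec₂.right)).of_eq fun p => by
      unfold Int.subNatNat
      cases p.2 - p.1 <;> rfl

theorem Primrec₂.int_natCast_sub : Primrec₂ fun a b : ℕ => (a : ℤ) - b :=
  Primrec₂.int_subNatNat.of_eq fun _ _ => Int.subNatNat_eq_coe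

theorem Primrec₂.int_sub : Primrec₂ ((· - ·) : ℤ → ℤ → ℤ) :=
  (Primrec₂.int_natCast_sub.comp
    (Primrec.nat_add.comp (Primrec.int_toNat.comp Primrec.fst)
      (Primrec.int_toNat_neg.comp Primrec.snd))
    (Primrec.nat_add.comp (Primrec.int_toNat_neg.comp Primrec.fst)
      (Primrec.int_toNat.comp Primrec.snd))).of_eq fun p => by
        push_cast
        lia

theorem Primrec.int_neg : Primrec (Neg.neg : ℤ → ℤ) :=
  (Primrec₂.int_sub.comp (Primrec.const 0) Primrec.id).of_eq fun z => zero_sub z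

theorem Primrec₂.int_add : Primrec₂ ((· + ·) : ℤ → ℤ → ℤ) :=
  (Primrec₂.int_sub.comp Primrec.fst (Primrec.int_neg.comp Primrec.snd)).of_eq
    fun p => sub_neg_eq_add p.1 p.2

theorem Primrec₂.int_mul : Primrec₂ ((· * ·) : ℤ → ℤ → ℤ) :=
  (Primrec₂.int_natCast_sub.comp
    (Primrec.nat_add.comp
      (Primrec.nat_mul.comp (Primrec.int_toNat.comp Primrec.fst)
        (Primrec.int_toNat.comp Primrec.snd))
      (Primrec.nat_mul.comp (Primrec.int_toNat_neg.comp Primrec.fst)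
        (Primrec.int_toNat_neg.comp Primrec.snd)))
    (Primrec.nat_add.comp
      (Primrec.nat_mul.comp (Primrec.int_toNat.comp Primrec.fst)
        (Primrec.int_toNat_neg.comp Primrec.snd))
      (Primrec.nat_mul.comp (Primrec.int_toNat_neg.comp Primrec.fst)
        (Primrec.int_toNat.comp Primrec.snd)))).of_eq fun p => by
          have h₁ := Int.toNat_sub_toNat_neg p.1
          have h₂ := Int.toNat_sub_toNat_neg p.2
          conv_rhs => rw [← h₁, ← h₂]
          push_cast
          ring

theorem Primrec.int_sign : Primrec Int.sign :=
  (Primrec₂.int_natCast_sub.comp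
    (Primrec.nat_min.comp Primrec.int_toNat (Primrec.const 1))
    (Primrec.nat_min.comp Primrec.int_toNat_neg (Primrec.const 1))).of_eq fun z => by
      rcases lt_trichotomy z 0 with h | rfl | h
      · rw [Int.sign_eq_neg_one_of_neg h]; lia
      · rfl
      · rw [Int.sign_eq_one_of_pos h]; lia

/-- Division of an integer by `2 * d`, rounded to a nearest integer. -/
def roundDiv (z : ℤ) (d : ℕ) : ℤ :=
  (((z.toNat + d) / (2 * d) : ℕ) : ℤ) - (((-z).toNat + d) / (2 * d) : ℕ)

theorem Primrec₂.roundDiv : Primrec₂ roundDiv := by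
  have key {f : ℤ → ℕ} (hf : Primrec f) :
      Primrec fun p : ℤ × ℕ => (f p.1 + p.2) / (2 * p.2) :=
    Primrec.nat_div.comp (Primrec.nat_add.comp (hf.comp Primrec.fst) Primrec.snd)
      (Primrec.nat_double.comp Primrec.snd)
  exact Primrec₂.int_natCast_sub.comp (key Primrec.int_toNat) (key Primrec.int_toNat_neg)

theorem abs_sub_two_mul_roundDiv_le (z : ℤ) {d : ℕ} (hd : 0 < d) :
    |z - 2 * d * roundDiv z d| ≤ d := by
  have key (a : ℕ) : |(a : ℤ) - 2 * d * ((a + d) / (2 * d) : ℕ)| ≤ d := by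
    have h₁ := Nat.div_add_mod (a + d) (2 * d)
    have h₂ := Nat.mod_lt (a + d) (show 0 < 2 * d by lia)
    have h₃ : ((2 * d * ((a + d) / (2 * d)) + (a + d) % (2 * d) : ℕ) : ℤ) = (a + d : ℕ) := by
      rw [h₁]
    rw [Nat.cast_add, Nat.cast_mul, Nat.cast_mul] at h₃
    rw [abs_le]
    push_cast at h₃ ⊢
    constructor <;> lia
  have hzero : d / (2 * d) = 0 := Nat.div_eq_of_lt (by lia)
  rcases le_total 0 z with hz | hz
  · have h := key z.toNat
    have hz' : (-z).toNat = 0 := by lia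
    rw [Int.toNat_of_nonneg hz] at h
    simpa [roundDiv, hz', hzero] using h
  · have h := key (-z).toNat
    have hz' : z.toNat = 0 := by lia
    rw [Int.toNat_of_nonneg (by lia), ← abs_neg] at h
    simp only [roundDiv, hz', hzero, zero_add]
    convert h using 2
    push_cast
    ring

/-- The numerator, over `2 ^ n`, of the `n`-th partial sum of `I + ∑ P i / 2 ^ i`. -/
def dyadicNum (I : ℤ) (P : ℕ → ℤ) (n : ℕ) : ℤ :=
  Nat.rec I (fun k r => 2 * r + P (k + 1)) n

theorem Primrec.dyadicNum (I : ℤ) {P : ℕ → ℤ} (hP : Primrec P) : Primrec (dyadicNum I P) :=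
  Primrec.nat_rec₁ I (Primrec₂.int_add.comp
    (Primrec₂.int_mul.comp (Primrec.const 2) Primrec.snd)
    (hP.comp (Primrec.succ.comp Primrec.fst)))

theorem dyadicNum_div (I : ℤ) (P : ℕ → ℤ) (n : ℕ) :
    (dyadicNum I P n : ℝ) / 2 ^ n = I + ∑ i ∈ Finset.Icc 1 n, (P i : ℝ) / 2 ^ i := by
  induction n with
  | zero => simp [dyadicNum]
  | succ n ih =>
    rw [Finset.sum_Icc_succ_top (by lia), ← add_assoc, ← ih]
    have h : dyadicNum I P (n + 1) = 2 * dyadicNum I P n + P (n + 1) := rfl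
    rw [h]
    push_cast
    field_simp
    ring

/-- A real number is representable if and only if a primitive recursive sequence of integers
approximates its multiples by powers of two with error at most one. -/
theorem sprcnRep_iff (x : ℝ) :
    SPRCNRep x ↔ ∃ A : ℕ → ℤ, Primrec A ∧ ∀ n, |2 ^ n * x - A n| ≤ 1 := by
  constructor
  · rintro ⟨I, P, hP, hd, hx⟩
    refine ⟨dyadicNum I P, Primrec.dyadicNum I hP, fun n => ?_⟩
    have hstep (k : ℕ) :
        |(dyadicNum I P (n + k) : ℝ) - 2 ^ k * dyadicNum I P n| ≤ 2 ^ k - 1 := by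
      induction k with
      | zero => simp
      | succ k ih =>
        have h : dyadicNum I P (n + (k + 1)) = 2 * dyadicNum I P (n + k) + P (n + k + 1) := rfl
        have hp : |(P (n + k + 1) : ℝ)| ≤ 1 := by
          rcases hd (n + k + 1) with h | h | h <;> simp [h]
        rw [h]
        push_cast
        rw [abs_le] at *
        constructor <;> rw [pow_succ] <;> linarith
    have hlim : Tendsto (fun m => |2 ^ n * ((dyadicNum I P m : ℝ) / 2 ^ m) - dyadicNum I P n|)
        atTop (nhds |2 ^ n * x - dyadicNum I P n|) := by
      simp_rw [dyadicNum_div]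
      exact ((hx.const_mul _).sub_const _).abs
    refine le_of_tendsto hlim ?_
    filter_upwards [eventually_ge_atTop n] with m hm
    obtain ⟨k, rfl⟩ := Nat.exists_eq_add_of_le hm
    have h : (2 : ℝ) ^ n * (dyadicNum I P (n + k) / 2 ^ (n + k)) - dyadicNum I P n =
        (dyadicNum I P (n + k) - 2 ^ k * dyadicNum I P n) / 2 ^ k := by
      rw [pow_add]
      field_simp
    rw [h, abs_div, abs_of_pos (by positivity : (0 : ℝ) < 2 ^ k), div_le_one (by positivity)]
    linarith [hstep k]
  · rintro ⟨A, hA, hx⟩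
    obtain ⟨Y, hY, hY0, hYs⟩ : ∃ Y : ℕ → ℤ, Primrec Y ∧ Y 0 = A 0 ∧
        ∀ n, Y (n + 1) = 2 * Y n + (A (n + 1) - 2 * Y n).sign := by
      have h2 : Primrec fun p : ℕ × ℤ => 2 * p.2 :=
        Primrec₂.int_mul.comp (Primrec.const 2) Primrec.snd
      exact ⟨_, Primrec.nat_rec₁ (f := fun k r => 2 * r + (A (k + 1) - 2 * r).sign) (A 0)
        (Primrec₂.int_add.comp h2 (Primrec.int_sign.comp
        (Primrec₂.int_sub.comp (hA.comp (Primrec.succ.comp Primrec.fst)) h2))),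
        rfl, fun _ => rfl⟩
    let P : ℕ → ℤ := fun n => (A n - 2 * Y (n - 1)).sign
    have hP : Primrec P := Primrec.int_sign.comp (Primrec₂.int_sub.comp hA
      (Primrec₂.int_mul.comp (Primrec.const 2) (hY.comp Primrec.pred)))
    have hYP : dyadicNum (A 0) P = Y := by
      funext n
      induction n with
      | zero => exact hY0.symm
      | succ n ih =>
        change 2 * dyadicNum (A 0) P n + P (n + 1) = _
        rw [ih, hYs]
        rfl
    have herr (n : ℕ) : |2 ^ n * x - Y n| ≤ 1 := by
      induction n with
      | zero => simpa only [hY0] using hx 0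
      | succ n ih =>
        have hA' := hx (n + 1)
        rw [hYs]
        rw [abs_le, pow_succ] at *
        rcases lt_trichotomy (A (n + 1) - 2 * Y n) 0 with hs | hs | hs
        · rw [Int.sign_eq_neg_one_of_neg hs]
          have hs' : (A (n + 1) : ℝ) ≤ 2 * Y n - 1 := by
            have h : A (n + 1) ≤ 2 * Y n - 1 := by lia
            exact_mod_cast h
          push_cast
          constructor <;> linarith
        · rw [hs]
          have hs' : (A (n + 1) : ℝ) = 2 * Y n := by
            have h : A (n + 1) = 2 * Y n := by lia
            exact_mod_cast h
          simp only [Int.sign_zero]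
          push_cast
          constructor <;> linarith
        · rw [Int.sign_eq_one_of_pos hs]
          have hs' : 2 * (Y n : ℝ) + 1 ≤ A (n + 1) := by
            have h : 2 * Y n + 1 ≤ A (n + 1) := by lia
            exact_mod_cast h
          push_cast
          constructor <;> linarith
    refine ⟨A 0, P, hP, fun i => ?_, ?_⟩
    · rcases lt_trichotomy (A i - 2 * Y (i - 1)) 0 with hs | hs | hs
      · exact .inl (Int.sign_eq_neg_one_of_neg hs)
      · exact .inr (.inl (by simp only [P, hs, Int.sign_zero]))
      · exact .inr (.inr (Int.sign_eq_one_of_pos hs))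
    · simp_rw [← dyadicNum_div, hYP]
      rw [tendsto_iff_dist_tendsto_zero]
      refine squeeze_zero (fun _ => dist_nonneg) (fun n => ?_)
        (tendsto_pow_atTop_nhds_zero_of_lt_one (by norm_num : (0 : ℝ) ≤ 1 / 2) (by norm_num))
      have h : (Y n : ℝ) / 2 ^ n - x = -(2 ^ n * x - Y n) / 2 ^ n := by
        field_simp
        ring
      rw [Real.dist_eq, h, abs_div, abs_neg, abs_of_pos (by positivity : (0 : ℝ) < 2 ^ n),
        one_div_pow]
      gcongr
      exact herr n

theorem stmt_10 (x y : ℝ) (hx : SPRCNRep x) (hy : SPRCNRep y) :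
    SPRCNRep (x * y) := by
  rw [sprcnRep_iff] at hx hy ⊢
  obtain ⟨A, hA, hxA⟩ := hx
  obtain ⟨B, hB, hyB⟩ := hy
  obtain ⟨k, hk⟩ := pow_unbounded_of_one_lt (|x| + |y| + 1) (one_lt_two (α := ℝ))
  have hpow : Primrec fun n : ℕ => 2 ^ (n + 2 * k + 1) := by
    have h := (Primrec.nat_rec₁ (f := fun _ r => 2 * r) (2 ^ (2 * k + 1))
      (Primrec.nat_double.comp₂ Primrec₂.right))
    refine h.of_eq fun n => ?_
    induction n with
    | zero => simp
    | succ n ih =>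
      simp only [ih]
      ring
  have hshift : Primrec fun n : ℕ => n + (k + 1) :=
    Primrec.nat_add.comp Primrec.id (Primrec.const _)
  refine ⟨fun n => roundDiv (A (n + (k + 1)) * B (n + (k + 1))) (2 ^ (n + 2 * k + 1)),
    Primrec₂.roundDiv.comp (Primrec₂.int_mul.comp (hA.comp hshift) (hB.comp hshift)) hpow,
    fun n => ?_⟩
  have hround := abs_sub_two_mul_roundDiv_le (A (n + (k + 1)) * B (n + (k + 1)))
    (d := 2 ^ (n + 2 * k + 1)) (by positivity)
  beta_reduce
  generalize roundDiv (A (n + (k + 1)) * B (n + (k + 1))) (2 ^ (n + 2 * k + 1)) = r at *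
  have ha := hxA (n + (k + 1))
  have hb := hyB (n + (k + 1))
  generalize (A (n + (k + 1))) = a at *
  generalize (B (n + (k + 1))) = b at *
  have hround' : |(a * b : ℝ) - 2 * 2 ^ (n + 2 * k + 1) * r| ≤ 2 ^ (n + 2 * k + 1) := by
    exact_mod_cast hround
  set M : ℝ := 2 ^ (n + (k + 1)) with hM
  have hM1 : 1 ≤ M := one_le_pow₀ (by norm_num)
  have hbabs : |(b : ℝ)| ≤ M * |y| + 1 := by
    have h := abs_sub_abs_le_abs_sub (b : ℝ) (M * y)
    rw [abs_sub_comm, abs_mul, abs_of_pos (by linarith : 0 < M)] at h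
    linarith
  have hprod : |M * x * (M * y) - a * b| ≤ 2 ^ (n + 2 * k + 1) := by
    calc |M * x * (M * y) - a * b| = |M * x * (M * y - b) + (M * x - a) * b| := by ring_nf
      _ ≤ |M * x| * |M * y - b| + |M * x - a| * |(b : ℝ)| := by
        rw [← abs_mul, ← abs_mul]
        exact abs_add_le _ _
      _ ≤ |M * x| * 1 + 1 * (M * |y| + 1) := by gcongr
      _ ≤ M * (|x| + |y| + 1) := by
        rw [abs_mul, abs_of_pos (by linarith : 0 < M)]
        linarith
      _ ≤ M * 2 ^ k := by gcongr
      _ = 2 ^ (n + 2 * k + 1) := by rw [hM]; ring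
  have hscale : 2 * 2 ^ (n + 2 * k + 1) * (2 ^ n * (x * y) - r) =
      (M * x * (M * y) - a * b) + (a * b - 2 * 2 ^ (n + 2 * k + 1) * r) := by
    rw [hM]
    ring
  have hD : (0 : ℝ) < 2 * 2 ^ (n + 2 * k + 1) := by positivity
  have habs : 2 * 2 ^ (n + 2 * k + 1) * |2 ^ n * (x * y) - r| ≤
      2 * 2 ^ (n + 2 * k + 1) * 1 := by
    rw [← abs_of_pos hD, ← abs_mul, abs_of_pos hD, hscale]
    refine (abs_add_le _ _).trans ?_
    linarith
  exact le_of_mul_le_mul_left habs hD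
end

section
/- Signed digit selection lemma: for every n ∈ ℕ and all rational numbers p and a with |a − p| ≤ 3·2^{−(n+1)}, there exists c ∈ {-1, 0, 1} (as an integer) such that |a − (p + c·2^{−n})| ≤ 2^{−(n+1)}. -/
theorem stmt_13 (n : ℕ) (p a : ℚ) (h : |a - p| ≤ 3 / 2 ^ (n + 1)) :
    ∃ c : ℤ, (c = -1 ∨ c = 0 ∨ c = 1) ∧
      |a - (p + (c : ℚ) / 2 ^ n)| ≤ 1 / 2 ^ (n + 1) := by
  have hthree : (3 : ℚ) / 2 ^ (n + 1) = 3 * (1 / 2 ^ (n + 1)) := by ring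
  have hdigit (c : ℚ) : c / 2 ^ n = c * (2 * (1 / 2 ^ (n + 1))) := by
    rw [pow_succ]
    field_simp
  simp only [hthree, hdigit, abs_le] at h ⊢
  generalize (1 : ℚ) / 2 ^ (n + 1) = r at h ⊢
  obtain ⟨hl, hu⟩ := h
  rcases lt_or_ge (a - p) (-r) with hneg | hneg
  · refine ⟨-1, by simp, ?_, ?_⟩ <;> push_cast <;> linarith
  rcases le_or_gt (a - p) r with hpos | hpos
  · refine ⟨0, by simp, ?_, ?_⟩ <;> push_cast <;> linarith
  · refine ⟨1, by simp, ?_, ?_⟩ <;> push_cast <;> linarith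
end

section
/- Convergence of Naive Generalized Computed Number sequences: let b : ℕ → ℕ → Bool and J : ℕ → ℕ be such that for each i ∈ ℕ, the set { j ∈ ℕ | b(i)(j+1) ≠ b(i)(j) } has at most J(i) elements (each coefficient changes value at most J(i) times). Define the rational sequence x(n) = ∑_{i=0}^{n} (if b(i)(n) then 2^{−i} else 0). Then the sequence (x(n)) converges to a real number. -/
open Filter

/-- A sequence whose set of change points is finite is eventually constant. -/
theorem exists_eventually_eq_of_changes_mem_finset {α : Type*} (u : ℕ → α) (s : Finset ℕ)
    (hs : ∀ j, u (j + 1) ≠ u j → j ∈ s) : ∃ c, ∀ᶠ n in atTop, u n = c := by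
  obtain ⟨N, hN⟩ := s.bddAbove
  refine ⟨u (N + 1), eventually_atTop.2 ⟨N + 1, fun n hn => ?_⟩⟩
  induction n, hn using Nat.le_induction with
  | base => rfl
  | succ n hn ih =>
    rw [← ih]
    by_contra h
    have : n ≤ N := hN (hs n h)
    omega

theorem stmt_15 (b : ℕ → ℕ → Bool) (J : ℕ → ℕ)
    (hchanges : ∀ i, ∃ s : Finset ℕ,
      (∀ j, b i (j + 1) ≠ b i j → j ∈ s) ∧ s.card ≤ J i)
    (x : ℕ → ℚ)
    (hx : ∀ n, x n = ∑ i ∈ Finset.range (n + 1),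
      (if b i n then ((2 : ℚ) ^ i)⁻¹ else 0)) :
    ∃ L : ℝ, Tendsto (fun n => (x n : ℝ)) atTop (nhds L) := by
  have hlim : ∀ i, ∃ c, ∀ᶠ n in atTop, b i n = c := fun i =>
    let ⟨s, hs, _⟩ := hchanges i
    exists_eventually_eq_of_changes_mem_finset (b i) s hs
  choose c hc using hlim
  let f : ℕ → ℕ → ℝ := fun n i =>
    if i ∈ Finset.range (n + 1) then (if b i n then ((2 : ℝ) ^ i)⁻¹ else 0) else 0
  have hxf : (fun n => (x n : ℝ)) = fun n => ∑' i, f n i := by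
    funext n
    rw [hx, tsum_eq_sum (s := Finset.range (n + 1)) fun i hi => if_neg hi]
    rw [Rat.cast_sum]
    refine Finset.sum_congr rfl fun i hi => ?_
    simp only [if_pos hi]
    split_ifs <;> simp
  refine ⟨∑' i, if c i then ((2 : ℝ) ^ i)⁻¹ else 0, ?_⟩
  rw [hxf]
  refine tendsto_tsum_of_dominated_convergence (bound := fun i => ((2 : ℝ) ^ i)⁻¹)
    (by simpa using summable_geometric_two) (fun i => ?_) (Eventually.of_forall fun n i => ?_)
  · refine tendsto_const_nhds.congr' ?_
    filter_upwards [hc i, eventually_ge_atTop i] with n hn hin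
    simp only [f, hn, if_pos (Finset.mem_range.2 (Nat.lt_succ_of_le hin))]
  · simp only [f]
    split_ifs <;> simp
end

section
/- Specker's theorem (version used in the paper): there exists a computable sequence q : ℕ → ℚ that is monotone nondecreasing and satisfies 0 ≤ q(n) ≤ 1 for all n, such that its limit x ∈ ℝ is not a computable real; that is, there is no computable sequence r : ℕ → ℚ with |r(n) − r(m)| ≤ 2^{−m} for all n ≥ m converging to x. -/
open Filter

/-- A real number `x` is a computable real if there exists a computable sequence
`r : ℕ → ℚ` with `|r n − r m| ≤ 2^{−m}` for all `n ≥ m`, converging to `x`. -/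
def IsComputableReal (x : ℝ) : Prop :=
  ∃ r : ℕ → ℚ, Computable r ∧
    (∀ m n, m ≤ n → |r n - r m| ≤ ((2 : ℚ) ^ m)⁻¹) ∧
    Tendsto (fun n => (r n : ℝ)) atTop (nhds x)

open Encodable Denumerable

theorem Computable.nat_find {p : ℕ → ℕ → Bool} (hp : Computable₂ p)
    (h : ∀ k, ∃ n, p k n = true) :
    Computable fun k => Nat.find (h k) := by
  refine Partrec.of_eq (Partrec.rfind (p := fun k n => Part.some (p k n)) hp) fun k => ?_
  refine Part.eq_some_iff.2 (Nat.mem_rfind.2 ⟨?_, fun {m} hm => ?_⟩)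
  · simpa using (Nat.find_spec (h k)).symm
  · simpa using (Nat.find_min (h k) hm)

theorem Computable.of_forall_iff {α : Type*} [Denumerable α] {p : ℕ → α → Bool}
    (hp : Computable₂ p) {f : ℕ → α} (h : ∀ n a, p n a = true ↔ f n = a) : Computable f := by
  have hp' : Computable₂ fun n m : ℕ => p n (ofNat α m) :=
    hp.comp Computable.fst ((Computable.ofNat α).comp Computable.snd)
  have hex : ∀ n, ∃ m, p n (ofNat α m) = true := fun n =>
    ⟨encode (f n), (h _ _).2 (Denumerable.ofNat_encode _).symm⟩
  exact ((Computable.ofNat α).comp (Computable.nat_find hp' hex)).of_eq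
    fun n => ((h _ _).1 (Nat.find_spec (hex n))).symm

/-- The code of a rational in the non-surjective encoding by numerator and denominator. -/
def Rat.code (q : ℚ) : ℕ := @encode ℚ Rat.instEncodable q

theorem Rat.code_eq (q : ℚ) : q.code = Nat.pair (Equiv.intEquivNat q.num) q.den := rfl

/-- The absolute value of the integer with a given code. -/
def codeAbs (c : ℕ) : ℕ := if c % 2 = 0 then c / 2 else c / 2 + 1

theorem codeAbs_intEquivNat (z : ℤ) : codeAbs (Equiv.intEquivNat z) = z.natAbs := by
  cases z with
  | ofNat n =>
    change codeAbs (2 * n) = n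
    simp [codeAbs]
  | negSucc n =>
    change codeAbs (2 * n + 1) = n + 1
    rw [codeAbs]
    split <;> omega

theorem primrec_codeAbs : Primrec codeAbs := by
  refine Primrec.ite ?_ ?_ ?_
  · exact Primrec.eq.comp (Primrec.nat_mod.comp .id (.const 2)) (.const 0)
  · exact Primrec.nat_div.comp .id (.const 2)
  · exact Primrec.succ.comp (Primrec.nat_div.comp .id (.const 2))

theorem mem_range_code_iff (n : ℕ) : n ∈ Set.range Rat.code ↔
    0 < n.unpair.2 ∧ ∀ d < n.unpair.2 + 1,
      d = 1 ∨ ¬ (codeAbs n.unpair.1 % d = 0 ∧ n.unpair.2 % d = 0) := by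
  have hcop : (0 < n.unpair.2 ∧ ∀ d < n.unpair.2 + 1,
      d = 1 ∨ ¬ (codeAbs n.unpair.1 % d = 0 ∧ n.unpair.2 % d = 0)) ↔
      0 < n.unpair.2 ∧ (codeAbs n.unpair.1).Coprime n.unpair.2 := by
    refine and_congr_right fun hb => ⟨fun h => ?_, fun h d _ => ?_⟩
    · refine (h (Nat.gcd _ _) (Nat.lt_succ_of_le (Nat.gcd_le_right _ hb))).resolve_right ?_
      rw [not_not]
      exact ⟨Nat.mod_eq_zero_of_dvd (Nat.gcd_dvd_left _ _),
        Nat.mod_eq_zero_of_dvd (Nat.gcd_dvd_right _ _)⟩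
    · rw [or_iff_not_imp_right, not_not]
      rintro ⟨h1, h2⟩
      exact Nat.eq_one_of_dvd_coprimes h (Nat.dvd_of_mod_eq_zero h1) (Nat.dvd_of_mod_eq_zero h2)
  rw [hcop]
  constructor
  · rintro ⟨q, rfl⟩
    rw [Rat.code_eq, Nat.unpair_pair, codeAbs_intEquivNat]
    exact ⟨q.pos, q.reduced⟩
  · rintro ⟨hb, hc⟩
    obtain ⟨z, hz⟩ := Equiv.intEquivNat.surjective n.unpair.1
    rw [← hz, codeAbs_intEquivNat] at hc
    refine ⟨⟨z, n.unpair.2, hb.ne', hc⟩, ?_⟩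
    rw [Rat.code_eq]
    simp [hz]

theorem primrecPred_mem_range_code : PrimrecPred (· ∈ Set.range Rat.code) := by
  have hb : Primrec fun n : ℕ => n.unpair.2 := Primrec.snd.comp Primrec.unpair
  have ha : Primrec fun n : ℕ => codeAbs n.unpair.1 :=
    primrec_codeAbs.comp (Primrec.fst.comp Primrec.unpair)
  have hR : PrimrecRel fun d n : ℕ =>
      d = 1 ∨ ¬ (codeAbs n.unpair.1 % d = 0 ∧ n.unpair.2 % d = 0) :=
    PrimrecPred.or (Primrec.eq.comp Primrec.fst (.const 1)) <| PrimrecPred.not <|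
      PrimrecPred.and
        (Primrec.eq.comp (Primrec.nat_mod.comp (ha.comp Primrec.snd) Primrec.fst) (.const 0))
        (Primrec.eq.comp (Primrec.nat_mod.comp (hb.comp Primrec.snd) Primrec.fst) (.const 0))
  refine PrimrecPred.of_eq (PrimrecPred.and (Primrec.nat_lt.comp (.const 0) hb)
    (hR.forall_lt.comp (Primrec.succ.comp hb) .id)) fun n => (mem_range_code_iff n).symm

theorem Rat.computable_code : Computable Rat.code := by
  classical
  let s : Set ℕ := Set.range Rat.code
  let _ : DecidablePred (· ∈ s) := @decidableRangeEncode ℚ Rat.instEncodable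
  have : Infinite s :=
    Infinite.of_injective _ (Equiv.ofInjective _ (@encode_injective ℚ Rat.instEncodable)).injective
  have hcode : ∀ n, (ofNat ℚ n).code = (Nat.Subtype.ofNat s n : ℕ) := fun n =>
    congrArg Subtype.val
      ((@equivRangeEncode ℚ Rat.instEncodable).apply_symm_apply (Nat.Subtype.ofNat s n))
  have hnext : ∀ k, ∃ n, decide (k < n ∧ n ∈ s) = true := by
    intro k
    obtain ⟨n, hn, hk⟩ := (Set.infinite_coe_iff.1 this).exists_gt k
    exact ⟨n, by simpa using ⟨hk, hn⟩⟩
  have hp : Computable₂ fun k n : ℕ => decide (k < n ∧ n ∈ s) := by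
    refine Primrec.to_comp (PrimrecPred.decide (p := fun t : ℕ × ℕ => t.1 < t.2 ∧ t.2 ∈ s) ?_)
    exact (PrimrecPred.and (Primrec.nat_lt.comp Primrec.fst Primrec.snd)
      (primrecPred_mem_range_code.comp Primrec.snd))
  have hg := Computable.nat_find hp hnext
  have hv : Computable fun n : ℕ => Nat.rec (motive := fun _ => ℕ)
      ((Nat.Subtype.ofNat s 0 : s) : ℕ) (fun _ k => Nat.find (hnext k)) n :=
    Computable.nat_rec Computable.id (Computable.const _)
      (hg.comp (Computable.snd.comp Computable.snd)).to₂
  refine (hv.comp (Computable.encode (α := ℚ))).of_eq fun q => ?_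
  obtain ⟨n, rfl⟩ := (eqv ℚ).symm.surjective q
  change Nat.rec _ _ (@encode ℚ Denumerable.toEncodable (ofNat ℚ n)) = (ofNat ℚ n).code
  rw [hcode, Denumerable.encode_ofNat]
  induction n with
  | zero => rfl
  | succ n ih =>
    change Nat.find (hnext _) = _
    rw [ih, Nat.find_eq_iff]
    have hlt : Nat.Subtype.ofNat s n < Nat.Subtype.ofNat s (n + 1) := Nat.Subtype.lt_succ_self _
    refine ⟨by simpa using hlt, fun m hm hm' => ?_⟩
    simp only [decide_eq_true_eq] at hm'
    have : Nat.Subtype.succ (Nat.Subtype.ofNat s n) ≤ ⟨m, hm'.2⟩ :=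
      Nat.Subtype.succ_le_of_lt hm'.1
    exact absurd hm (not_lt.2 this)

theorem Rat.computable_den : Computable Rat.den :=
  ((Primrec.snd.comp Primrec.unpair).to_comp.comp Rat.computable_code).of_eq fun q => by
    simp [Rat.code_eq]

theorem Rat.computable_natAbs_num : Computable fun q : ℚ => q.num.natAbs :=
  ((primrec_codeAbs.comp (Primrec.fst.comp Primrec.unpair)).to_comp.comp
    Rat.computable_code).of_eq fun q => by
    simp [Rat.code_eq, codeAbs_intEquivNat]

theorem Rat.computable_num_toNat : Computable fun q : ℚ => q.num.toNat := by
  have h : Primrec fun n : ℕ => if n.unpair.1 % 2 = 0 then n.unpair.1 / 2 else 0 := by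
    have h1 := Primrec.fst.comp Primrec.unpair
    exact Primrec.ite (Primrec.eq.comp (Primrec.nat_mod.comp h1 (.const 2)) (.const 0))
      (Primrec.nat_div.comp h1 (.const 2)) (.const 0)
  refine (h.to_comp.comp Rat.computable_code).of_eq fun q => ?_
  rw [Rat.code_eq, Nat.unpair_pair]
  cases q.num with
  | ofNat n =>
    change (if 2 * n % 2 = 0 then 2 * n / 2 else 0) = n
    simp
  | negSucc n =>
    change (if (2 * n + 1) % 2 = 0 then (2 * n + 1) / 2 else 0) = 0
    rw [if_neg (by omega)]

theorem Rat.div_eq_iff_num_den (q : ℚ) (a b : ℕ) (hb : 0 < b) :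
    (a / b : ℚ) = q ↔
      q.num.toNat * b = a * q.den ∧ q.num.natAbs * b = a * q.den := by
  have hb' : (b : ℚ) ≠ 0 := by positivity
  have hd : (q.den : ℚ) ≠ 0 := by simp
  conv_lhs => rw [← Rat.num_div_den q, div_eq_div_iff hb' hd]
  rw [← Nat.cast_inj (R := ℤ), ← Nat.cast_inj (R := ℤ)]
  push_cast
  rcases le_or_gt 0 q.num with h | h
  · rw [Int.toNat_of_nonneg h, abs_of_nonneg h, and_self, eq_comm]
    norm_cast
  · have h1 : q.num * b < 0 := mul_neg_of_neg_of_pos h (by exact_mod_cast hb)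
    have h2 : (0 : ℤ) ≤ a * q.den := by positivity
    have h3 : 0 < |q.num| * b := mul_pos (abs_pos.2 h.ne) (by exact_mod_cast hb)
    constructor
    · intro h'
      have : (a * q.den : ℤ) = q.num * b := by exact_mod_cast h'
      omega
    · rintro ⟨h4, h5⟩
      rw [Int.toNat_of_nonpos h.le] at h4
      push_cast at h4
      omega

theorem Computable.natCast_div {a b : ℕ → ℕ} (ha : Computable a) (hb : Computable b)
    (hb0 : ∀ n, 0 < b n) : Computable fun n => (a n / b n : ℚ) := by
  have hmul : Computable₂ fun m n : ℕ => m * n := Primrec.nat_mul.to_comp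
  have heq : Computable₂ fun m n : ℕ => decide (m = n) := Primrec.eq.decide.to_comp
  have hbn : Computable fun t : ℕ × ℚ => b t.1 := hb.comp Computable.fst
  have hpos : Computable fun t : ℕ × ℚ => t.2.num.toNat * b t.1 :=
    hmul.comp (Rat.computable_num_toNat.comp Computable.snd) hbn
  have habs : Computable fun t : ℕ × ℚ => t.2.num.natAbs * b t.1 :=
    hmul.comp (Rat.computable_natAbs_num.comp Computable.snd) hbn
  have hden : Computable fun t : ℕ × ℚ => a t.1 * t.2.den :=
    hmul.comp (ha.comp Computable.fst) (Rat.computable_den.comp Computable.snd)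
  refine Computable.of_forall_iff (p := fun n q =>
    decide (q.num.toNat * b n = a n * q.den) && decide (q.num.natAbs * b n = a n * q.den))
    (Primrec.and.to_comp.comp (heq.comp hpos hden) (heq.comp habs hden)).to₂ fun n q => ?_
  rw [Rat.div_eq_iff_num_den _ _ _ (hb0 n), Bool.and_eq_true, decide_eq_true_eq,
    decide_eq_true_eq]

theorem computable_two_pow : Computable fun n : ℕ => 2 ^ n :=
  ((Primrec₂.unpaired'.1 Nat.Primrec.pow).comp (.const 2) .id).to_comp

/-- Whether the program with code `k` halts on input `0` within `N` steps. -/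
def haltsWithin (N k : ℕ) : Bool := (Nat.Partrec.Code.evaln N (ofNat Nat.Partrec.Code k) 0).isSome

theorem primrec_haltsWithin : Primrec₂ haltsWithin :=
  Primrec.to₂ <| Primrec.option_isSome.comp <| Nat.Partrec.Code.primrec_evaln.comp <|
    (Primrec.fst.pair ((Primrec.ofNat Nat.Partrec.Code).comp Primrec.snd)).pair (Primrec.const 0)

theorem haltsWithin_mono {M N k : ℕ} (h : M ≤ N) (hM : haltsWithin M k = true) :
    haltsWithin N k = true := by
  obtain ⟨x, hx⟩ := Option.isSome_iff_exists.1 hM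
  exact Option.isSome_iff_exists.2 ⟨x, Nat.Partrec.Code.evaln_mono h hx⟩

theorem not_computable_of_haltsWithin (f : ℕ → Bool) (hf : Computable f) :
    ¬ ∀ k, f k = true ↔ ∃ N, haltsWithin N k = true := by
  intro h
  refine ComputablePred.halting_problem 0 (ComputablePred.computable_iff.2
    ⟨fun c => f (encode c), hf.comp Computable.encode, funext fun c => propext ?_⟩)
  rw [h]
  simp only [haltsWithin, Denumerable.ofNat_encode, Option.isSome_iff_exists, Part.dom_iff_mem]
  rw [exists_comm]
  exact exists_congr fun x => Nat.Partrec.Code.evaln_complete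

/-- The numerator, over the denominator `2 ^ j`, of the partial sum over the programs `k < j` that
halt within `N` steps of `2⁻¹ ^ (k + 1)`. -/
def speckerNum (N j : ℕ) : ℕ :=
  Nat.rec (motive := fun _ => ℕ) 0 (fun k a => 2 * a + (haltsWithin N k).toNat) j

theorem primrec_speckerNum : Primrec₂ speckerNum := by
  have hbit : Primrec fun t : ℕ × ℕ × ℕ => (haltsWithin t.1 t.2.1).toNat :=
    (Primrec.dom_bool Bool.toNat).comp
      (primrec_haltsWithin.comp Primrec.fst (Primrec.fst.comp Primrec.snd))
  have hdouble : Primrec fun t : ℕ × ℕ × ℕ => 2 * t.2.2 :=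
    Primrec.nat_mul.comp (.const 2) (Primrec.snd.comp Primrec.snd)
  exact Primrec.nat_rec (f := fun _ : ℕ => 0)
    (g := fun N p => 2 * p.2 + (haltsWithin N p.1).toNat) (.const 0)
    (Primrec.nat_add.comp hdouble hbit).to₂

/-- The partial sums of `∑ 2⁻¹ ^ (k + 1)` over the programs `k < N` that halt within `N` steps. -/
def specker (N : ℕ) : ℚ := speckerNum N N / (2 ^ N : ℕ)

theorem computable_specker : Computable specker :=
  Computable.natCast_div (primrec_speckerNum.comp .id .id).to_comp computable_two_pow
    fun n => by positivity

theorem specker_eq_sum (N : ℕ) :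
    specker N = ∑ k ∈ Finset.range N, ((haltsWithin N k).toNat : ℚ) * 2⁻¹ ^ (k + 1) := by
  have h : ∀ j, (speckerNum N j : ℚ) / 2 ^ j =
      ∑ k ∈ Finset.range j, ((haltsWithin N k).toNat : ℚ) * 2⁻¹ ^ (k + 1) := by
    intro j
    induction j with
    | zero => simp [speckerNum]
    | succ j ih =>
      rw [Finset.sum_range_succ, ← ih,
        show speckerNum N (j + 1) = 2 * speckerNum N j + (haltsWithin N j).toNat from rfl]
      push_cast
      rw [inv_pow]
      field_simp
      ring
  rw [← h, specker, Nat.cast_pow, Nat.cast_ofNat]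

theorem toNat_haltsWithin_mono {M N : ℕ} (h : M ≤ N) (k : ℕ) :
    (haltsWithin M k).toNat ≤ (haltsWithin N k).toNat := by
  cases hM : haltsWithin M k
  · simp
  · simp [haltsWithin_mono h hM]

theorem specker_mono : Monotone specker := by
  intro M N h
  rw [specker_eq_sum, specker_eq_sum]
  refine (Finset.sum_le_sum fun k _ => ?_).trans
    (Finset.sum_le_sum_of_subset_of_nonneg (Finset.range_mono h) fun k _ _ => by positivity)
  gcongr
  exact toNat_haltsWithin_mono h k

theorem specker_nonneg (N : ℕ) : 0 ≤ specker N := by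
  rw [specker_eq_sum]
  positivity

theorem specker_le_one (N : ℕ) : specker N ≤ 1 := by
  have h : ∑ k ∈ Finset.range N, (2⁻¹ : ℚ) ^ (k + 1) = 1 - 2⁻¹ ^ N := by
    induction N with
    | zero => simp
    | succ n ih => rw [Finset.sum_range_succ, ih]; ring
  have h2 : specker N ≤ ∑ k ∈ Finset.range N, (2⁻¹ : ℚ) ^ (k + 1) := by
    rw [specker_eq_sum]
    refine Finset.sum_le_sum fun k _ => mul_le_of_le_one_left (by positivity) ?_
    exact_mod_cast Bool.toNat_le _
  have h3 : (0 : ℚ) ≤ 2⁻¹ ^ N := by positivity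
  linarith

/-- A program found to halt only after stage `M` makes `specker` jump after stage `M`. -/
theorem specker_add_le {M N k : ℕ} (hMN : M ≤ N) (hkN : k < N)
    (hM : haltsWithin M k = false) (hN : haltsWithin N k = true) :
    specker M + 2⁻¹ ^ (k + 1) ≤ specker N := by
  have hM' : specker M ≤
      ∑ i ∈ Finset.range N, ((haltsWithin M i).toNat : ℚ) * 2⁻¹ ^ (i + 1) := by
    rw [specker_eq_sum]
    exact Finset.sum_le_sum_of_subset_of_nonneg (Finset.range_mono hMN)
      fun k _ _ => by positivity
  have hk : k ∈ Finset.range N := Finset.mem_range.2 hkN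
  rw [specker_eq_sum N, ← Finset.add_sum_erase _ _ hk]
  rw [← Finset.add_sum_erase _ _ hk] at hM'
  have hle : ∑ i ∈ (Finset.range N).erase k, ((haltsWithin M i).toNat : ℚ) * 2⁻¹ ^ (i + 1) ≤
      ∑ i ∈ (Finset.range N).erase k, ((haltsWithin N i).toNat : ℚ) * 2⁻¹ ^ (i + 1) := by
    gcongr with i
    exact toNat_haltsWithin_mono hMN i
  simp only [hM, hN, Bool.toNat_false, Bool.toNat_true, Nat.cast_zero, zero_mul, Nat.cast_one,
    one_mul] at hM' ⊢
  linarith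

theorem Rat.num_toNat_mul_lt_iff (r : ℚ) {a b : ℕ} (hb : 0 < b) :
    r.num.toNat * b < a * r.den ↔ max r 0 < (a / b : ℚ) := by
  have hd : (0 : ℚ) < r.den := by exact_mod_cast r.pos
  have hr : max r 0 = (r.num.toNat : ℚ) / r.den := by
    rcases le_or_gt 0 r with h | h
    · rw [max_eq_left h]
      conv_lhs => rw [← Rat.num_div_den r]
      congr 1
      exact_mod_cast (Int.toNat_of_nonneg (Rat.num_nonneg.2 h)).symm
    · rw [max_eq_right h.le, Int.toNat_of_nonpos (Rat.num_neg.2 h).le]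
      simp
  rw [hr, div_lt_div_iff₀ hd (by exact_mod_cast hb)]
  norm_cast

/-- A computable approximation to the limit of `specker` computes a modulus of convergence. -/
theorem not_isComputableReal_of_tendsto_specker {x : ℝ}
    (hx : Tendsto (fun n => (specker n : ℝ)) atTop (nhds x)) : ¬ IsComputableReal x := by
  rintro ⟨r, hr, hrc, hrx⟩
  have hle : ∀ N, (specker N : ℝ) ≤ x := fun N =>
    Monotone.ge_of_tendsto (fun m n h => by exact_mod_cast specker_mono h) hx N
  have hx0 : 0 ≤ x := le_trans (by exact_mod_cast specker_nonneg 0) (hle 0)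
  have hdist : ∀ m, |x - (r m : ℝ)| ≤ 2⁻¹ ^ m := by
    intro m
    refine le_of_tendsto ((hrx.sub_const _).abs) ?_
    filter_upwards [eventually_ge_atTop m] with n hn
    have := (Rat.cast_le (K := ℝ)).2 (hrc m n hn)
    rw [inv_pow]
    push_cast at this
    exact this
  let a : ℕ → ℕ → ℕ := fun k N => speckerNum N N * 2 ^ (k + 2) + 2 ^ N
  have ha : ∀ k N, ((a k N : ℕ) / ((2 ^ N * 2 ^ (k + 2) : ℕ) : ℚ)) =
      specker N + 2⁻¹ ^ (k + 2) := by
    intro k N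
    simp only [a, specker, inv_pow]
    push_cast
    field_simp
  have hex : ∀ k, ∃ N, decide ((r (k + 3)).num.toNat * (2 ^ N * 2 ^ (k + 2)) <
      a k N * (r (k + 3)).den) = true := by
    intro k
    have hpos : (0 : ℝ) < 2⁻¹ ^ (k + 3) := by positivity
    obtain ⟨N, hN⟩ := (hx.eventually_const_lt (sub_lt_self x hpos)).exists
    refine ⟨N, ?_⟩
    rw [decide_eq_true_eq, Rat.num_toNat_mul_lt_iff _ (by positivity), ha,
      ← Rat.cast_lt (K := ℝ)]
    have h1 := abs_le.1 (hdist (k + 3))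
    have h2 : (2⁻¹ : ℝ) ^ (k + 2) = 2 * 2⁻¹ ^ (k + 3) := by ring
    push_cast
    rw [h2]
    refine max_lt ?_ ?_ <;> linarith
  have hp : Computable₂ fun k N : ℕ => decide ((r (k + 3)).num.toNat * (2 ^ N * 2 ^ (k + 2)) <
      a k N * (r (k + 3)).den) := by
    have hN : Computable fun t : ℕ × ℕ => 2 ^ t.2 := computable_two_pow.comp Computable.snd
    have hk : Computable fun t : ℕ × ℕ => 2 ^ (t.1 + 2) :=
      computable_two_pow.comp (Primrec.nat_add.comp Primrec.fst (.const 2)).to_comp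
    have hr' : Computable fun t : ℕ × ℕ => r (t.1 + 3) :=
      hr.comp (Primrec.nat_add.comp Primrec.fst (.const 3)).to_comp
    have hmul := Primrec.nat_mul.to_comp
    have ha' : Computable fun t : ℕ × ℕ => a t.1 t.2 :=
      Primrec.nat_add.to_comp.comp (hmul.comp
        ((primrec_speckerNum.comp .id .id).comp Primrec.snd).to_comp hk) hN
    exact Primrec.nat_lt.decide.to_comp.comp
      (hmul.comp (Rat.computable_num_toNat.comp hr') (hmul.comp hN hk))
      (hmul.comp ha' (Rat.computable_den.comp hr'))
  have hg := Computable.nat_find hp hex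
  refine not_computable_of_haltsWithin (fun k => haltsWithin (Nat.find (hex k)) k)
    (primrec_haltsWithin.to_comp.comp hg Computable.id) fun k => ⟨fun h => ⟨_, h⟩, ?_⟩
  rintro ⟨N, hN⟩
  have hspec := Nat.find_spec (hex k)
  set M := Nat.find (hex k)
  rw [decide_eq_true_eq, Rat.num_toNat_mul_lt_iff _ (by positivity), ha] at hspec
  have hspec' : (r (k + 3) : ℝ) < specker M + 2⁻¹ ^ (k + 2) := by
    have := (Rat.cast_lt (K := ℝ)).2 ((le_max_left _ _).trans_lt hspec)
    push_cast at this
    exact this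
  by_contra hM
  let L := max M (max N (k + 1))
  have hjump := specker_add_le (M := M) (N := L) (k := k) (le_max_left _ _)
    (Nat.lt_of_succ_le ((le_max_right _ _).trans (le_max_right _ _))) (by simpa using hM)
    (haltsWithin_mono ((le_max_left _ _).trans (le_max_right _ _)) hN)
  have hjump' : (specker M : ℝ) + 2⁻¹ ^ (k + 1) ≤ specker L := by
    have := (Rat.cast_le (K := ℝ)).2 hjump
    push_cast at this
    exact this
  have h1 := abs_le.1 (hdist (k + 3))
  have h2 : (2⁻¹ : ℝ) ^ (k + 2) = 2 * 2⁻¹ ^ (k + 3) := by ring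
  have h3 : (2⁻¹ : ℝ) ^ (k + 1) = 4 * 2⁻¹ ^ (k + 3) := by ring
  have hpos : (0 : ℝ) < 2⁻¹ ^ (k + 3) := by positivity
  have := hle L
  linarith

theorem stmt_16 :
    ∃ q : ℕ → ℚ, Computable q ∧ Monotone q ∧
      (∀ n, 0 ≤ q n ∧ q n ≤ 1) ∧
      ∃ x : ℝ, Tendsto (fun n => (q n : ℝ)) atTop (nhds x) ∧
        ¬ IsComputableReal x := by
  have hlim := tendsto_atTop_ciSup (f := fun n => (specker n : ℝ))
    (fun m n h => Rat.cast_le.2 (specker_mono h))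
    ⟨1, by rintro _ ⟨n, rfl⟩; exact_mod_cast Rat.cast_le.2 (specker_le_one n)⟩
  exact ⟨specker, computable_specker, specker_mono,
    fun n => ⟨specker_nonneg n, specker_le_one n⟩, _, hlim,
    not_isComputableReal_of_tendsto_specker hlim⟩
end
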